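/- Let n ≥ 3 and for each ε ∈ (0, 4/(n−2)) let w_ε ∈ C²([0,∞)) satisfy (r^{n−1}w_ε'(r))' = −|w_ε(r)|^{p_ε−1}w_ε(r)·r^{n−1} for r > 0, w_ε(0) = 1, w_ε'(0) = 0. Let 0 = s_{1,ε} < r_{1,ε} < s_{2,ε} < r_{2,ε} < … be the interlaced increasing sequences of all critical points (s_{i,ε}) and zeros (r_{i,ε}) of w_ε. Then, as ε → 0⁺: (i) for every m ≥ 1, r_{m,ε}·(κ_n ε)^{(2m−1)/(n−2)} → (n(n−2))^{1/2}·m^{1/(2−n)}·Γ(m)^{−2/(n−2)}; (ii) for every m ≥ 1, |w_ε'(r_{m,ε})|·(κ_n ε)^{(1−mn)/(n−2)} → ((n−2)/n)^{1/2}·m^{(n−1)/(n−2)}·Γ(m)^{n/(n−2)}; (iii) for every m ≥ 2, s_{m,ε}·(κ_n ε)^{(2mn−3n+2)/(n(n−2))} → (n(n−2))^{1/2}·(m−1)^{1/n}·Γ(m)^{−2/(n−2)}; (iv) for every m ≥ 2, |w_ε(s_{m,ε})|·(κ_n ε)^{1−m} → Γ(m). -/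

import Mathlib

open Real Set Filter Topology MeasureTheory

noncomputable section

/-- `κ_n = ((n-2)/4) · Γ(n/2)² / Γ(n)`. -/
def kappa (n : ℕ) : ℝ :=
  (((n : ℝ) - 2) / 4) * Real.Gamma ((n : ℝ) / 2) ^ 2 / Real.Gamma (n : ℝ)

/-- `p_ε = (n+2)/(n-2) - ε`. -/
def pEps (n : ℕ) (ε : ℝ) : ℝ := ((n : ℝ) + 2) / ((n : ℝ) - 2) - ε

/-- `u ∈ C²([0,1])` is a radial solution of `-Δu = |u|^{p-1} u` on the unit ball of `ℝⁿ`,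
written in the radial variable: `(r^{n-1} u')' = -|u|^{p-1} u · r^{n-1}` on `(0,1]`,
with `u'(0) = 0`. -/
def IsRadialSolution (n : ℕ) (p : ℝ) (u : ℝ → ℝ) : Prop :=
  ContDiffOn ℝ 2 u (Set.Icc 0 1) ∧ deriv u 0 = 0 ∧
    ∀ r ∈ Set.Ioc (0 : ℝ) 1,
      deriv (fun s => s ^ (n - 1) * deriv u s) r = -(|u r| ^ (p - 1) * u r * r ^ (n - 1))

/-- Radial Dirichlet solution with exactly `m-1` interior zeros, together with the
decreasing enumeration of its zeros `ρ 1 = 1 > ρ 2 > … > ρ m > 0` in `(0,1]` and of its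
critical points `1 > δ 1 > … > δ m = 0` in `[0,1]`, interlaced as
`0 = δ m < ρ m < δ (m-1) < … < δ 1 < ρ 1 = 1`. -/
def DirichletData (n : ℕ) (p : ℝ) (m : ℕ) (u : ℝ → ℝ) (ρ δ : ℕ → ℝ) : Prop :=
  IsRadialSolution n p u ∧ u 1 = 0 ∧ ρ 1 = 1 ∧ δ m = 0 ∧
    (∀ k, 1 ≤ k → k ≤ m → δ k < ρ k) ∧
    (∀ k, 1 ≤ k → k + 1 ≤ m → ρ (k + 1) < δ k) ∧
    {r : ℝ | r ∈ Set.Ioc (0 : ℝ) 1 ∧ u r = 0} = ρ '' Set.Icc 1 m ∧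
    {r : ℝ | r ∈ Set.Icc (0 : ℝ) 1 ∧ deriv u r = 0} = δ '' Set.Icc 1 m

/-- Radial Neumann solution with exactly `m-1` interior zeros, together with the
decreasing enumeration of its zeros `1 > ρ 1 > … > ρ (m-1) > 0` in `(0,1)` and of its
critical points `δ 1 = 1 > δ 2 > … > δ m = 0` in `[0,1]`, interlaced as
`0 = δ m < ρ (m-1) < δ (m-1) < … < ρ 1 < δ 1 = 1`. -/
def NeumannData (n : ℕ) (p : ℝ) (m : ℕ) (u : ℝ → ℝ) (ρ δ : ℕ → ℝ) : Prop :=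
  IsRadialSolution n p u ∧ deriv u 1 = 0 ∧ δ 1 = 1 ∧ δ m = 0 ∧
    (∀ k, 1 ≤ k → k ≤ m - 1 → ρ k < δ k) ∧
    (∀ k, 1 ≤ k → k ≤ m - 1 → δ (k + 1) < ρ k) ∧
    {r : ℝ | r ∈ Set.Ioo (0 : ℝ) 1 ∧ u r = 0} = ρ '' Set.Icc 1 (m - 1) ∧
    {r : ℝ | r ∈ Set.Icc (0 : ℝ) 1 ∧ deriv u r = 0} = δ '' Set.Icc 1 m

/-- A nontrivial radial Dirichlet solution with exactly `m-1` interior zeros. -/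
def DirichletSol (n : ℕ) (p : ℝ) (m : ℕ) (u : ℝ → ℝ) : Prop :=
  IsRadialSolution n p u ∧ u 1 = 0 ∧ (∃ r ∈ Set.Icc (0 : ℝ) 1, u r ≠ 0) ∧
    ∃ Z : Finset ℝ, (Z : Set ℝ) = {r | r ∈ Set.Ioo (0 : ℝ) 1 ∧ u r = 0} ∧ Z.card = m - 1

/-- A nontrivial radial Neumann solution with exactly `m-1` interior zeros. -/
def NeumannSol (n : ℕ) (p : ℝ) (m : ℕ) (u : ℝ → ℝ) : Prop :=
  IsRadialSolution n p u ∧ deriv u 1 = 0 ∧ (∃ r ∈ Set.Icc (0 : ℝ) 1, u r ≠ 0) ∧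
    ∃ Z : Finset ℝ, (Z : Set ℝ) = {r | r ∈ Set.Ioo (0 : ℝ) 1 ∧ u r = 0} ∧ Z.card = m - 1


lemma mono_aux {f f' : ℝ → ℝ} {a b : ℝ} (hab : a ≤ b) (hc : ContinuousOn f (Icc a b))
    (hd : ∀ x ∈ Ioo a b, HasDerivAt f (f' x) x) (h0 : ∀ x ∈ Ioo a b, 0 ≤ f' x) : f a ≤ f b := by
  have h : MonotoneOn f (Icc a b) := by
    apply monotoneOn_of_deriv_nonneg (convex_Icc a b) hc
    · rw [interior_Icc]
      exact fun x hx => (hd x hx).differentiableAt.differentiableWithinAt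
    · rw [interior_Icc]
      intro x hx
      rw [(hd x hx).deriv]
      exact h0 x hx
  exact h (left_mem_Icc.2 hab) (right_mem_Icc.2 hab) hab

/-- the exponent, in terms of `k = n - 2` -/
def pp (k : ℕ) (ε : ℝ) : ℝ := ((k : ℝ) + 4) / k - ε

/-- one normalized nodal region followed by the piece up to the next critical point -/
structure Bub (k : ℕ) (ε σ ρ τ : ℝ) (v v1 : ℝ → ℝ) : Prop where
  hk : 1 ≤ k
  he : 0 < ε
  hek : ε * k ≤ 1
  hσ : 0 ≤ σ
  hσρ : σ < ρ
  hρτ : ρ < τ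
  cv : ContinuousOn v (Icc σ τ)
  cv1 : ContinuousOn v1 (Icc σ τ)
  dv : ∀ r ∈ Ioo σ τ, HasDerivAt v (v1 r) r
  dv1 : ∀ r ∈ Ioo σ τ,
    HasDerivAt v1 (-(((k : ℝ) + 1) / r * v1 r) - |v r| ^ (pp k ε - 1) * v r) r
  vσ : v σ = 1
  v1σ : v1 σ = 0
  vρ : v ρ = 0
  v1τ : v1 τ = 0
  vpos : ∀ r ∈ Ico σ ρ, 0 < v r
  vneg : ∀ r ∈ Ioc ρ τ, v r < 0
  v1neg : ∀ r ∈ Ioo σ τ, v1 r < 0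

lemma f_pos {x p : ℝ} (hx : 0 < x) : |x| ^ (p - 1) * x = x ^ p := by
  rw [abs_of_pos hx, Real.rpow_sub_one hx.ne']; field_simp

lemma f_neg {x p : ℝ} (hx : x < 0) : |x| ^ (p - 1) * x = -(-x) ^ p := by
  have := f_pos (p := p) (neg_pos.2 hx)
  rw [abs_neg] at this; linarith

/-- Pohozaev function -/
def PP (k : ℕ) (ε : ℝ) (v v1 : ℝ → ℝ) (r : ℝ) : ℝ :=
  r ^ (k + 2) * (v1 r ^ 2 / 2 + |v r| ^ (pp k ε + 1) / (pp k ε + 1))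
    + k / 2 * r ^ (k + 1) * (v r * v1 r)

def aa (k : ℕ) (ε : ℝ) : ℝ := k * ε / (2 * (pp k ε + 1))

lemma pp_gt {k : ℕ} {ε : ℝ} (hk : 1 ≤ k) (hek : ε * k ≤ 1) : 1 + 3 / (k : ℝ) ≤ pp k ε := by
  have : (0 : ℝ) < k := by exact_mod_cast hk
  have h2 : ε ≤ 1 / k := by rwa [le_div_iff₀ this]
  have : ((k : ℝ) + 4) / k = 1 + 4 / k := by field_simp
  unfold pp
  rw [this]
  have : (4 : ℝ) / k = 3 / k + 1 / k := by ring
  linarith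

lemma pp_gt1 {k : ℕ} {ε : ℝ} (hk : 1 ≤ k) (hek : ε * k ≤ 1) : 1 < pp k ε := by
  have := pp_gt hk hek
  have : (0 : ℝ) < k := by exact_mod_cast hk
  have : 0 < 3 / (k : ℝ) := by positivity
  linarith

/-- derivative of the Pohozaev function where the solution is positive. -/
lemma poho_deriv {k : ℕ} {ε r x1 : ℝ} {u u1 : ℝ → ℝ} (hk : 1 ≤ k) (hek : ε * k ≤ 1)
    (hr : 0 < r) (hu : 0 < u r)
    (d0 : HasDerivAt u (u1 r) r) (hx1 : x1 = -(((k : ℝ) + 1) / r * u1 r) - u r ^ pp k ε)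
    (d1 : HasDerivAt u1 x1 r) :
    HasDerivAt (fun r => r ^ (k + 2) * (u1 r ^ 2 / 2 + u r ^ (pp k ε + 1) / (pp k ε + 1))
      + k / 2 * r ^ (k + 1) * (u r * u1 r)) (aa k ε * (r ^ (k + 1) * u r ^ (pp k ε + 1))) r := by
  have hp := pp_gt1 hk hek
  have hk' : (0 : ℝ) < k := by exact_mod_cast hk
  have e1 := (hasDerivAt_pow (k + 2) r)
  have e2 := (hasDerivAt_pow (k + 1) r)
  have e3 := d0.rpow_const (p := pp k ε + 1) (Or.inl hu.ne')
  have := (e1.mul (((d1.pow 2).div_const 2).add (e3.div_const (pp k ε + 1)))).add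
    ((e2.const_mul ((k : ℝ) / 2)).mul (d0.mul d1))
  refine HasDerivAt.congr_deriv this ?_
  simp only [Pi.add_apply, Pi.mul_apply, Pi.pow_apply, Nat.add_sub_cancel]
  have e4 : u r ^ (pp k ε + 1) = u r ^ pp k ε * u r := Real.rpow_add_one hu.ne' _
  have e5 : pp k ε + 1 - 1 = pp k ε := by ring
  have e6 : aa k ε = (k + 2) / (pp k ε + 1) - k / 2 := by
    have h1 : pp k ε + 1 ≠ 0 := by linarith
    unfold aa
    field_simp
    unfold pp
    field_simp
    ring
  rw [e5, e4, hx1, e6]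
  have h1 : pp k ε + 1 ≠ 0 := by linarith
  push_cast
  field_simp
  ring

namespace Bub
variable {k : ℕ} {ε σ ρ τ : ℝ} {v v1 : ℝ → ℝ}

lemma rpos (h : Bub k ε σ ρ τ v v1) {r : ℝ} (hr : σ < r) : 0 < r := lt_of_le_of_lt h.hσ hr

lemma dv1p (h : Bub k ε σ ρ τ v v1) {r : ℝ} (hr : r ∈ Ioo σ ρ) :
    HasDerivAt v1 (-(((k : ℝ) + 1) / r * v1 r) - v r ^ pp k ε) r := by
  have := h.dv1 r ⟨hr.1, hr.2.trans h.hρτ⟩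
  rwa [f_pos (h.vpos r ⟨hr.1.le, hr.2⟩)] at this

lemma dv1n (h : Bub k ε σ ρ τ v v1) {r : ℝ} (hr : r ∈ Ioo ρ τ) :
    HasDerivAt v1 (-(((k : ℝ) + 1) / r * v1 r) + (-v r) ^ pp k ε) r := by
  have := h.dv1 r ⟨h.hσρ.trans hr.1, hr.2⟩
  rw [f_neg (h.vneg r ⟨hr.1, hr.2.le⟩)] at this
  simpa using this

lemma dPp (h : Bub k ε σ ρ τ v v1) {r : ℝ} (hr : r ∈ Ioo σ ρ) :
    HasDerivAt (PP k ε v v1) (aa k ε * (r ^ (k + 1) * v r ^ (pp k ε + 1))) r := by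
  have hr' : r ∈ Ioo σ τ := ⟨hr.1, hr.2.trans h.hρτ⟩
  have := poho_deriv h.hk h.hek (h.rpos hr.1) (h.vpos r ⟨hr.1.le, hr.2⟩) (h.dv r hr') rfl (h.dv1p hr)
  refine this.congr_of_eventuallyEq ?_
  filter_upwards [Ioo_mem_nhds hr.1 hr.2] with x hx
  simp only [PP]
  rw [abs_of_pos (h.vpos x ⟨hx.1.le, hx.2⟩)]

lemma dPn (h : Bub k ε σ ρ τ v v1) {r : ℝ} (hr : r ∈ Ioo ρ τ) :
    HasDerivAt (PP k ε v v1) (aa k ε * (r ^ (k + 1) * (-v r) ^ (pp k ε + 1))) r := by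
  have hr' : r ∈ Ioo σ τ := ⟨h.hσρ.trans hr.1, hr.2⟩
  have := poho_deriv (u := fun r => - v r) (u1 := fun r => - v1 r) h.hk h.hek (h.rpos hr'.1)
    (neg_pos.2 (h.vneg r ⟨hr.1, hr.2.le⟩)) (h.dv r hr').neg (by ring) (h.dv1n hr).neg
  refine this.congr_of_eventuallyEq ?_
  filter_upwards [Ioo_mem_nhds hr.1 hr.2] with x hx
  simp only [PP]
  rw [abs_of_neg (h.vneg x ⟨hx.1, hx.2.le⟩)]
  ring

lemma cP (h : Bub k ε σ ρ τ v v1) : ContinuousOn (PP k ε v v1) (Icc σ τ) := by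
  have hp := pp_gt1 h.hk h.hek
  have hv := h.cv
  have hv1 := h.cv1
  have : ContinuousOn (fun r => |v r| ^ (pp k ε + 1)) (Icc σ τ) :=
    hv.abs.rpow_const (fun x _ => Or.inr (by linarith))
  unfold PP
  fun_prop

end Bub

namespace Bub
variable {k : ℕ} {ε σ ρ τ : ℝ} {v v1 : ℝ → ℝ}

lemma kpos (h : Bub k ε σ ρ τ v v1) : (0 : ℝ) < k := by exact_mod_cast h.hk

lemma anti (h : Bub k ε σ ρ τ v v1) {s t : ℝ} (hs : σ ≤ s) (hst : s ≤ t) (ht : t ≤ τ) :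
    v t ≤ v s := by
  have := mono_aux (f := fun r => - v r) (f' := fun r => - v1 r) hst
    ((h.cv.mono (Icc_subset_Icc hs ht)).neg)
    (fun x hx => (h.dv x ⟨hs.trans_lt hx.1, hx.2.trans_le ht⟩).neg)
    (fun x hx => (neg_pos.2 (h.v1neg x ⟨hs.trans_lt hx.1, hx.2.trans_le ht⟩)).le)
  linarith

lemma vle1 (h : Bub k ε σ ρ τ v v1) {s : ℝ} (hs : σ ≤ s) (ht : s ≤ τ) : v s ≤ 1 := by
  rw [← h.vσ]; exact h.anti le_rfl hs ht

lemma dfluxp (h : Bub k ε σ ρ τ v v1) {r : ℝ} (hr : r ∈ Ioo σ ρ) :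
    HasDerivAt (fun r => r ^ (k + 1) * v1 r) (-(r ^ (k + 1) * v r ^ pp k ε)) r := by
  have hr0 := h.rpos hr.1
  refine ((hasDerivAt_pow (k + 1) r).mul (h.dv1p hr)).congr_deriv ?_
  simp only [Nat.add_sub_cancel]
  push_cast
  field_simp
  ring

lemma dfluxn (h : Bub k ε σ ρ τ v v1) {r : ℝ} (hr : r ∈ Ioo ρ τ) :
    HasDerivAt (fun r => r ^ (k + 1) * v1 r) (r ^ (k + 1) * (-v r) ^ pp k ε) r := by
  have hr0 := h.rpos (h.hσρ.trans hr.1)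
  refine ((hasDerivAt_pow (k + 1) r).mul (h.dv1n hr)).congr_deriv ?_
  simp only [Nat.add_sub_cancel]
  push_cast
  field_simp
  ring

lemma flux_low (h : Bub k ε σ ρ τ v v1) {r : ℝ} (hr : r ∈ Ioo σ ρ) :
    v r ^ pp k ε * (r ^ (k + 2) - σ ^ (k + 2)) / (k + 2) ≤ -(r ^ (k + 1) * v1 r) := by
  have hp := pp_gt1 h.hk h.hek
  have hs : Icc σ r ⊆ Icc σ τ := Icc_subset_Icc le_rfl (hr.2.trans h.hρτ).le
  have := mono_aux (f := fun t => -(t ^ (k + 1) * v1 t) - v r ^ pp k ε * t ^ (k + 2) / (k + 2))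
    (f' := fun t => t ^ (k + 1) * (v t ^ pp k ε - v r ^ pp k ε)) hr.1.le
    (by have := h.cv1.mono hs
        fun_prop)
    (fun x hx => by
      refine ((h.dfluxp ⟨hx.1, hx.2.trans hr.2⟩).neg.sub
        (((hasDerivAt_pow (k + 2) x).const_mul (v r ^ pp k ε)).div_const ((k : ℝ) + 2))).congr_deriv ?_
      push_cast
      field_simp)
    (fun x hx => by
      have hx0 := h.rpos hx.1
      have h1 := h.anti hx.1.le hx.2.le (hr.2.trans h.hρτ).le
      have h2 := Real.rpow_le_rpow (h.vpos r ⟨hr.1.le, hr.2⟩).le h1 (by linarith : 0 ≤ pp k ε)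
      have : 0 ≤ v x ^ pp k ε - v r ^ pp k ε := by linarith
      positivity)
  simp only [h.v1σ] at this
  have e : v r ^ pp k ε * (r ^ (k + 2) - σ ^ (k + 2)) / (k + 2) =
    v r ^ pp k ε * r ^ (k + 2) / (k + 2) - v r ^ pp k ε * σ ^ (k + 2) / (k + 2) := by ring
  rw [e]; linarith

lemma Q_low (h : Bub k ε σ ρ τ v v1) {r : ℝ} (hr : r ∈ Ioo σ ρ) :
    σ ^ (k + 2) * (k / (2 * (k + 2))) ≤
     r ^ (k + 2) * (v1 r ^ 2 / 2 + k / (2 * (k + 2)) * v r ^ (pp k ε + 1))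
      + k / 2 * r ^ (k + 1) * (v r * v1 r) := by
  have hp := pp_gt1 h.hk h.hek
  have hk := h.kpos
  have hs : Icc σ r ⊆ Icc σ τ := Icc_subset_Icc le_rfl (hr.2.trans h.hρτ).le
  have := mono_aux (f := fun r => r ^ (k + 2) * (v1 r ^ 2 / 2 + k / (2 * (k + 2)) * v r ^ (pp k ε + 1))
      + k / 2 * r ^ (k + 1) * (v r * v1 r))
    (f' := fun t => -(k * ε / (2 * (k + 2))) * (t ^ (k + 2) * v t ^ pp k ε * v1 t)) hr.1.le
    (by have := h.cv1.mono hs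
        have h2 := h.cv.mono hs
        have h3 : ContinuousOn (fun r => v r ^ (pp k ε + 1)) (Icc σ r) :=
          h2.rpow_const (fun x _ => Or.inr (by linarith))
        fun_prop)
    (fun x hx => by
      have hx0 := h.rpos hx.1
      have hx' : x ∈ Ioo σ ρ := ⟨hx.1, hx.2.trans hr.2⟩
      have hu := h.vpos x ⟨hx.1.le, hx'.2⟩
      have d0 := h.dv x ⟨hx.1, hx'.2.trans h.hρτ⟩
      have d1 := h.dv1p hx'
      have e3 := d0.rpow_const (p := pp k ε + 1) (Or.inl hu.ne')
      have := ((hasDerivAt_pow (k + 2) x).mul (((d1.pow 2).div_const 2).add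
        (e3.const_mul ((k : ℝ) / (2 * (k + 2)))))).add
        (((hasDerivAt_pow (k + 1) x).const_mul ((k : ℝ) / 2)).mul (d0.mul d1))
      refine HasDerivAt.congr_deriv this ?_
      simp only [Pi.add_apply, Pi.mul_apply, Pi.pow_apply, Nat.add_sub_cancel]
      have e4 : v x ^ (pp k ε + 1) = v x ^ pp k ε * v x := Real.rpow_add_one hu.ne' _
      have e5 : pp k ε + 1 - 1 = pp k ε := by ring
      rw [e5, e4]
      push_cast
      generalize v x ^ pp k ε = y
      unfold pp
      field_simp
      ring)
    (fun x hx => by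
      have hx0 := h.rpos hx.1
      have hx' : x ∈ Ioo σ ρ := ⟨hx.1, hx.2.trans hr.2⟩
      have hu := h.vpos x ⟨hx.1.le, hx'.2⟩
      have h1 := h.v1neg x ⟨hx.1, hx'.2.trans h.hρτ⟩
      have h2 := h.he
      have : 0 ≤ (k * ε / (2 * (k + 2))) * (x ^ (k + 2) * v x ^ pp k ε * (-v1 x)) := by
        have : 0 ≤ - v1 x := by linarith
        positivity
      linarith)
  simp only [h.v1σ, h.vσ, Real.one_rpow] at this
  refine le_trans (le_of_eq ?_) this
  ring

/-- `G + (σ/r)^n / n` is nondecreasing, and at least `1/n`. -/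
lemma G_low (h : Bub k ε σ ρ τ v v1) {r : ℝ} (hr : r ∈ Ioo σ ρ) :
    1 / ((k : ℝ) + 2) ≤
      -(v1 r * v r ^ (-2 / (k : ℝ) - 1) / r) + σ ^ (k + 2) / (k + 2) / r ^ (k + 2) := by
  have hp := pp_gt h.hk h.hek
  have hk := h.kpos
  have key : ∀ s ∈ Ioo σ r, v s ^ (pp k ε - 2 / k - 1) / (k + 2) ≤
      -(v1 r * v r ^ (-2 / (k : ℝ) - 1) / r) + σ ^ (k + 2) / (k + 2) / r ^ (k + 2) := by
    intro s hs
    have hs0 := h.rpos hs.1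
    have hs' : s ∈ Ioo σ ρ := ⟨hs.1, hs.2.trans hr.2⟩
    have hvs := h.vpos s ⟨hs.1.le, hs'.2⟩
    have hsub : Icc s r ⊆ Icc σ τ := Icc_subset_Icc hs.1.le (hr.2.trans h.hρτ).le
    have m := mono_aux (f := fun r => -(v1 r * v r ^ (-2 / (k : ℝ) - 1) / r)
        + σ ^ (k + 2) / (k + 2) / r ^ (k + 2))
      (f' := fun r => v r ^ (-2 / (k : ℝ) - 1 - 1) / r * (2 * (k + 2) / k) / r ^ (k + 2) *
        (r ^ (k + 2) * (v1 r ^ 2 / 2 + k / (2 * (k + 2)) * v r ^ (pp k ε + 1))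
      + k / 2 * r ^ (k + 1) * (v r * v1 r)) - σ ^ (k + 2) / r ^ (k + 3)) hs.2.le
      (by
        have c1 := h.cv1.mono hsub
        have c2 := h.cv.mono hsub
        have c3 : ContinuousOn (fun r => v r ^ (-2 / (k : ℝ) - 1)) (Icc s r) :=
          c2.rpow_const (fun x hx => Or.inl
            (h.vpos x ⟨hs.1.le.trans hx.1, hx.2.trans_lt hr.2⟩).ne')
        have c4 : ∀ x ∈ Icc s r, x ≠ 0 := fun x hx => (hs0.trans_le hx.1).ne'
        have c5 : ∀ x ∈ Icc s r, x ^ (k + 2) ≠ 0 := fun x hx => pow_ne_zero _ (c4 x hx)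
        fun_prop (disch := assumption))
      (fun x hx => by
        have hx0 := hs0.trans hx.1
        have hx' : x ∈ Ioo σ ρ := ⟨hs.1.trans hx.1, hx.2.trans hr.2⟩
        have hu := h.vpos x ⟨hx'.1.le, hx'.2⟩
        have d0 := h.dv x ⟨hx'.1, hx'.2.trans h.hρτ⟩
        have d1 := h.dv1p hx'
        have e3 := d0.rpow_const (p := -2 / (k : ℝ) - 1) (Or.inl hu.ne')
        have := (((d1.mul e3).div (hasDerivAt_id x) hx0.ne').neg).add
          ((hasDerivAt_const x (σ ^ (k + 2) / ((k : ℝ) + 2))).div (hasDerivAt_pow (k + 2) x)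
            (pow_ne_zero _ hx0.ne'))
        refine HasDerivAt.congr_deriv this ?_
        simp only [Pi.mul_apply, id]
        have e4 : v x ^ (pp k ε + 1) = v x ^ pp k ε * v x := Real.rpow_add_one hu.ne' _
        have e5 : v x ^ (-2 / (k : ℝ) - 1) = v x ^ (-2 / (k : ℝ) - 1 - 1) * v x := by
          rw [← Real.rpow_add_one hu.ne']; congr 1; ring
        rw [e5, e4]
        push_cast
        generalize v x ^ pp k ε = y
        generalize v x ^ (-2 / (k : ℝ) - 1 - 1) = z
        field_simp
        ring)
      (fun x hx => by
        have hx0 := hs0.trans hx.1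
        have hx' : x ∈ Ioo σ ρ := ⟨hs.1.trans hx.1, hx.2.trans hr.2⟩
        have hu := h.vpos x ⟨hx'.1.le, hx'.2⟩
        have hq := h.Q_low hx'
        have h1 : 1 ≤ v x ^ (-2 / (k : ℝ) - 1 - 1) := by
          apply Real.one_le_rpow_of_pos_of_le_one_of_nonpos hu (h.vle1 hx'.1.le (hx'.2.trans h.hρτ).le)
          have : 0 < 2 / (k : ℝ) := by positivity
          rw [neg_div]; linarith
        set QQ := (x ^ (k + 2) * (v1 x ^ 2 / 2 + k / (2 * (k + 2)) * v x ^ (pp k ε + 1))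
          + k / 2 * x ^ (k + 1) * (v x * v1 x))
        have hσ := h.hσ
        have hA : 0 ≤ σ ^ (k + 2) * ((k : ℝ) / (2 * (k + 2))) := by positivity
        have h2 : 1 * (σ ^ (k + 2) * (k / (2 * (k + 2)))) ≤ v x ^ (-2 / (k : ℝ) - 1 - 1) * QQ :=
          mul_le_mul h1 hq hA (by linarith)
        have h3 : v x ^ (-2 / (k : ℝ) - 1 - 1) / x * (2 * (k + 2) / k) / x ^ (k + 2) * QQ
            - σ ^ (k + 2) / x ^ (k + 3) = (2 * (k + 2) / k) / x ^ (k + 3) *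
            (v x ^ (-2 / (k : ℝ) - 1 - 1) * QQ - 1 * (σ ^ (k + 2) * (k / (2 * (k + 2))))) := by
          field_simp
          ring
        rw [h3]
        apply mul_nonneg (by positivity)
        linarith)
    refine le_trans ?_ m
    have hf := h.flux_low hs'
    have e5 : v s ^ (pp k ε - 2 / k - 1) = v s ^ (pp k ε) * v s ^ (-2 / (k : ℝ) - 1) := by
      rw [← Real.rpow_add hvs]; congr 1; ring
    have hle : v s ^ (pp k ε - 2 / k - 1) ≤ 1 := by
      apply Real.rpow_le_one hvs.le (h.vle1 hs.1.le (hs'.2.trans h.hρτ).le)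
      have : 0 < 1 / (k : ℝ) := by positivity
      have : 3 / (k : ℝ) = 2 / k + 1 / k := by ring
      linarith
    have hz : 0 < v s ^ (-2 / (k : ℝ) - 1) := by positivity
    have h2 := mul_le_mul_of_nonneg_left hf hz.le
    have hσ := h.hσ
    have h4 : v s ^ (pp k ε - 2 / k - 1) * σ ^ (k + 2) ≤ 1 * σ ^ (k + 2) :=
      mul_le_mul_of_nonneg_right hle (by positivity)
    rw [e5] at h4 ⊢
    have hs2 : 0 < s ^ (k + 2) := by positivity
    have e6 : -(v1 s * v s ^ (-2 / (k : ℝ) - 1) / s) + σ ^ (k + 2) / (k + 2) / s ^ (k + 2)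
       - v s ^ (pp k ε) * v s ^ (-2 / (k : ℝ) - 1) / (k + 2) =
       ((v s ^ (-2 / (k : ℝ) - 1) * -(s ^ (k + 1) * v1 s)) -
        (v s ^ (-2 / (k : ℝ) - 1) * (v s ^ pp k ε * (s ^ (k + 2) - σ ^ (k + 2)) / (k + 2)))
        + (1 * σ ^ (k + 2) - v s ^ (pp k ε) * v s ^ (-2 / (k : ℝ) - 1) * σ ^ (k + 2)) / (k + 2)) / s ^ (k + 2) := by
      field_simp
      ring
    have e7 : 0 ≤ -(v1 s * v s ^ (-2 / (k : ℝ) - 1) / s) + σ ^ (k + 2) / (k + 2) / s ^ (k + 2)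
       - v s ^ (pp k ε) * v s ^ (-2 / (k : ℝ) - 1) / (k + 2) := by
      rw [e6]
      apply div_nonneg _ hs2.le
      have : 0 ≤ (1 * σ ^ (k + 2) - v s ^ (pp k ε) * v s ^ (-2 / (k : ℝ) - 1) * σ ^ (k + 2)) / ((k : ℝ) + 2) := by
        apply div_nonneg <;> linarith
      linarith
    linarith
  have hc : Tendsto (fun s => v s ^ (pp k ε - 2 / k - 1) / ((k : ℝ) + 2)) (𝓝[>] σ)
      (𝓝 ((1 : ℝ) ^ (pp k ε - 2 / k - 1) / ((k : ℝ) + 2))) := by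
    have h1 : Tendsto v (𝓝[>] σ) (𝓝 1) := by
      rw [← h.vσ]
      have := h.cv σ ⟨le_rfl, (h.hσρ.trans h.hρτ).le⟩
      exact this.mono_left (by
        rw [← nhdsWithin_Ioo_eq_nhdsGT (h.hσρ.trans h.hρτ)]
        exact nhdsWithin_mono _ Ioo_subset_Icc_self)
    exact (h1.rpow_const (Or.inl one_ne_zero)).div_const _
  rw [Real.one_rpow] at hc
  refine le_of_tendsto hc ?_
  filter_upwards [Ioo_mem_nhdsGT hr.1] with s hs using key s hs

lemma phi_low (h : Bub k ε σ ρ τ v v1) {r : ℝ} (hr : r ∈ Ioo σ ρ) :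
    1 - σ ^ 2 / k ^ 2 + r ^ 2 / ((k + 2) * k) ≤ v r ^ (-2 / (k : ℝ)) := by
  have hk := h.kpos
  have hσ := h.hσ
  have key : ∀ s ∈ Ioo σ r, 1 - s ^ 2 / k ^ 2 + r ^ 2 / ((k + 2) * k) ≤ v r ^ (-2 / (k : ℝ)) := by
    intro s hs
    have hs0 := h.rpos hs.1
    have hr0 := h.rpos hr.1
    have hs' : s ∈ Ioo σ ρ := ⟨hs.1, hs.2.trans hr.2⟩
    have hvs := h.vpos s ⟨hs.1.le, hs'.2⟩
    have hsub : Icc s r ⊆ Icc σ τ := Icc_subset_Icc hs.1.le (hr.2.trans h.hρτ).le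
    have m := mono_aux (f := fun r => v r ^ (-2 / (k : ℝ)) - r ^ 2 / ((k + 2) * k)
        - 2 * σ ^ (k + 2) / ((k + 2) * k * k) / r ^ k)
      (f' := fun r => 2 * r / k * (-(v1 r * v r ^ (-2 / (k : ℝ) - 1) / r)
        + σ ^ (k + 2) / (k + 2) / r ^ (k + 2) - 1 / (k + 2))) hs.2.le
      (by
        have c2 := h.cv.mono hsub
        have c3 : ContinuousOn (fun r => v r ^ (-2 / (k : ℝ))) (Icc s r) :=
          c2.rpow_const (fun x hx => Or.inl
            (h.vpos x ⟨hs.1.le.trans hx.1, hx.2.trans_lt hr.2⟩).ne')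
        have c4 : ∀ x ∈ Icc s r, x ≠ 0 := fun x hx => (hs0.trans_le hx.1).ne'
        have c5 : ∀ x ∈ Icc s r, x ^ k ≠ 0 := fun x hx => pow_ne_zero _ (c4 x hx)
        fun_prop (disch := assumption))
      (fun x hx => by
        have hx0 := hs0.trans hx.1
        have hx' : x ∈ Ioo σ ρ := ⟨hs.1.trans hx.1, hx.2.trans hr.2⟩
        have hu := h.vpos x ⟨hx'.1.le, hx'.2⟩
        have d0 := h.dv x ⟨hx'.1, hx'.2.trans h.hρτ⟩
        have e3 := d0.rpow_const (p := -2 / (k : ℝ)) (Or.inl hu.ne')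
        have := (e3.sub ((hasDerivAt_pow 2 x).div_const (((k : ℝ) + 2) * k))).sub
          ((hasDerivAt_const x (2 * σ ^ (k + 2) / (((k : ℝ) + 2) * k * k))).div (hasDerivAt_pow k x)
            (pow_ne_zero _ hx0.ne'))
        refine HasDerivAt.congr_deriv this ?_
        generalize v x ^ (-2 / (k : ℝ) - 1) = z
        obtain ⟨j, rfl⟩ : ∃ j, k = j + 1 := ⟨k - 1, by have := h.hk; omega⟩
        simp only [Nat.add_sub_cancel]
        push_cast at hk ⊢
        field_simp
        ring)
      (fun x hx => by
        have hx0 := hs0.trans hx.1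
        have hx' : x ∈ Ioo σ ρ := ⟨hs.1.trans hx.1, hx.2.trans hr.2⟩
        have := h.G_low hx'
        apply mul_nonneg (by positivity)
        linarith)
    have h1 : 1 ≤ v s ^ (-2 / (k : ℝ)) := by
      apply Real.one_le_rpow_of_pos_of_le_one_of_nonpos hvs (h.vle1 hs'.1.le (hs'.2.trans h.hρτ).le)
      have : 0 < 2 / (k : ℝ) := by positivity
      rw [neg_div]; linarith
    have h2 : 2 * σ ^ (k + 2) / (((k : ℝ) + 2) * k * k) / s ^ k ≤ 2 * s ^ 2 / (((k : ℝ) + 2) * k * k) := by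
      have : σ ^ (k + 2) ≤ s ^ (k + 2) := pow_le_pow_left₀ hσ hs.1.le _
      rw [div_le_iff₀ (by positivity), div_mul_eq_mul_div]
      apply div_le_div_of_nonneg_right _ (by positivity)
      rw [pow_add, pow_add s] at this
      rw [pow_add]
      nlinarith [this]
    have h3 : 0 ≤ 2 * σ ^ (k + 2) / (((k : ℝ) + 2) * k * k) / r ^ k := by positivity
    have h4 : s ^ 2 / (k : ℝ) ^ 2 = s ^ 2 / ((k + 2) * k) + 2 * s ^ 2 / (((k : ℝ) + 2) * k * k) := by
      field_simp
    linarith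
  have hc : Tendsto (fun s : ℝ => 1 - s ^ 2 / k ^ 2 + r ^ 2 / (((k : ℝ) + 2) * k)) (𝓝[>] σ)
      (𝓝 (1 - σ ^ 2 / k ^ 2 + r ^ 2 / (((k : ℝ) + 2) * k))) := by
    have : Continuous (fun s : ℝ => 1 - s ^ 2 / k ^ 2 + r ^ 2 / (((k : ℝ) + 2) * k)) := by fun_prop
    exact (this.tendsto σ).mono_left nhdsWithin_le_nhds
  refine le_of_tendsto hc ?_
  filter_upwards [Ioo_mem_nhdsGT hr.1] with s hs using key s hs

lemma v_up (h : Bub k ε σ ρ τ v v1) {r d : ℝ} (hr : r ∈ Ioo σ ρ) (hd : d = 1 - σ ^ 2 / k ^ 2)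
    (hd0 : 0 < d) : v r ≤ (d + r ^ 2 / ((k + 2) * k)) ^ (-(k : ℝ) / 2) := by
  have hk := h.kpos
  have h1 := h.phi_low hr
  have hv := h.vpos r ⟨hr.1.le, hr.2⟩
  rw [← hd] at h1
  have h2 : 0 < d + r ^ 2 / (((k : ℝ) + 2) * k) := by positivity
  have h3 := Real.rpow_le_rpow_of_nonpos h2 h1 (by rw [neg_div]; linarith : -(k : ℝ) / 2 ≤ 0)
  rw [← Real.rpow_mul hv.le] at h3
  have : -2 / (k : ℝ) * (-(k : ℝ) / 2) = 1 := by field_simp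
  rwa [this, Real.rpow_one] at h3

end Bub


lemma dbase (k : ℕ) (d t : ℝ) :
    HasDerivAt (fun t : ℝ => d + t ^ 2 / (((k : ℝ) + 2) * k)) (2 * t / (((k : ℝ) + 2) * k)) t := by
  have := ((hasDerivAt_pow 2 t).div_const (((k : ℝ) + 2) * k)).const_add d
  refine this.congr_deriv ?_
  push_cast; ring

lemma base_pos {k : ℕ} {d : ℝ} (hd : 0 < d) (t : ℝ) :
    0 < d + t ^ 2 / (((k : ℝ) + 2) * k) := by positivity

lemma dU1 {k : ℕ} (hk : 1 ≤ k) {d : ℝ} (hd : 0 < d) (t : ℝ) :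
    HasDerivAt (fun t : ℝ => (d + t ^ 2 / (((k : ℝ) + 2) * k)) ^ (-(k : ℝ) / 2))
      (-(t * (d + t ^ 2 / (((k : ℝ) + 2) * k)) ^ (-((k : ℝ) + 2) / 2) / (k + 2))) t := by
  have hk' : (0 : ℝ) < k := by exact_mod_cast hk
  have := (dbase k d t).rpow_const (p := -(k : ℝ) / 2) (Or.inl (base_pos hd t).ne')
  refine this.congr_deriv ?_
  have : -(k : ℝ) / 2 - 1 = -((k : ℝ) + 2) / 2 := by ring
  rw [this]
  field_simp

lemma dU2 {k : ℕ} (hk : 1 ≤ k) {d : ℝ} (hd : 0 < d) (t : ℝ) :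
    HasDerivAt (fun t : ℝ => t ^ (k + 2) * (d + t ^ 2 / (((k : ℝ) + 2) * k)) ^ (-((k : ℝ) + 2) / 2)
        / ((k + 2) * d))
      (t ^ (k + 1) * (d + t ^ 2 / (((k : ℝ) + 2) * k)) ^ (-((k : ℝ) + 4) / 2)) t := by
  have hk' : (0 : ℝ) < k := by exact_mod_cast hk
  have hb := base_pos (k := k) hd t
  have h1 := (dbase k d t).rpow_const (p := -((k : ℝ) + 2) / 2) (Or.inl hb.ne')
  have := ((hasDerivAt_pow (k + 2) t).mul h1).div_const (((k : ℝ) + 2) * d)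
  refine this.congr_deriv ?_
  have e1 : -((k : ℝ) + 2) / 2 - 1 = -((k : ℝ) + 4) / 2 := by ring
  have e2 : (d + t ^ 2 / (((k : ℝ) + 2) * k)) ^ (-((k : ℝ) + 2) / 2) =
     (d + t ^ 2 / (((k : ℝ) + 2) * k)) ^ (-((k : ℝ) + 4) / 2) * (d + t ^ 2 / (((k : ℝ) + 2) * k)) := by
    rw [← Real.rpow_add_one hb.ne']; congr 1; ring
  rw [e1, e2]
  generalize (d + t ^ 2 / (((k : ℝ) + 2) * k)) ^ (-((k : ℝ) + 4) / 2) = z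
  push_cast
  field_simp
  ring

namespace Bub
variable {k : ℕ} {ε σ ρ τ : ℝ} {v v1 : ℝ → ℝ}

lemma flux_up (h : Bub k ε σ ρ τ v v1) {r d R : ℝ} (hr : r ∈ Ioo σ ρ) (hrR : r ≤ R)
    (hd : d = 1 - σ ^ 2 / k ^ 2) (hd0 : 0 < d) :
    -(r ^ (k + 1) * v1 r) ≤ (1 + R ^ 2 / ((k + 2) * k)) ^ (ε * k / 2) *
      (r ^ (k + 2) * (d + r ^ 2 / (((k : ℝ) + 2) * k)) ^ (-((k : ℝ) + 2) / 2) / ((k + 2) * d)) := by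
  have hp := pp_gt1 h.hk h.hek
  have hk := h.kpos
  have hσ := h.hσ
  have he := h.he
  set K := (1 + R ^ 2 / (((k : ℝ) + 2) * k)) ^ (ε * k / 2) with hK
  have hK0 : 0 < K := by positivity
  have hs : Icc σ r ⊆ Icc σ τ := Icc_subset_Icc le_rfl (hr.2.trans h.hρτ).le
  have m := mono_aux (f := fun t => t ^ (k + 1) * v1 t + K *
      (t ^ (k + 2) * (d + t ^ 2 / (((k : ℝ) + 2) * k)) ^ (-((k : ℝ) + 2) / 2) / ((k + 2) * d)))
    (f' := fun t => -(t ^ (k + 1) * v t ^ pp k ε) + K *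
      (t ^ (k + 1) * (d + t ^ 2 / (((k : ℝ) + 2) * k)) ^ (-((k : ℝ) + 4) / 2))) hr.1.le
    (by have := h.cv1.mono hs
        have c2 : ContinuousOn (fun t : ℝ => (t ^ (k + 2) *
          (d + t ^ 2 / (((k : ℝ) + 2) * k)) ^ (-((k : ℝ) + 2) / 2) / ((k + 2) * d))) (Icc σ r) :=
          fun x _ => (dU2 h.hk hd0 x).continuousAt.continuousWithinAt
        fun_prop)
    (fun x hx => (h.dfluxp ⟨hx.1, hx.2.trans hr.2⟩).add ((dU2 h.hk hd0 x).const_mul K))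
    (fun x hx => by
      have hx' : x ∈ Ioo σ ρ := ⟨hx.1, hx.2.trans hr.2⟩
      have hx0 := h.rpos hx.1
      have hv := h.vpos x ⟨hx.1.le, hx'.2⟩
      have h1 := h.v_up hx' hd hd0
      have hb := base_pos (k := k) hd0 x
      have h2 := Real.rpow_le_rpow hv.le h1 (by linarith : 0 ≤ pp k ε)
      rw [← Real.rpow_mul hb.le] at h2
      have e : -(k : ℝ) / 2 * pp k ε = ε * k / 2 + -((k : ℝ) + 4) / 2 := by
        unfold pp; field_simp; ring
      rw [e, Real.rpow_add hb] at h2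
      have h3 : (d + x ^ 2 / (((k : ℝ) + 2) * k)) ^ (ε * k / 2) ≤ K := by
        apply Real.rpow_le_rpow hb.le _ (by positivity)
        have : x ^ 2 ≤ R ^ 2 := pow_le_pow_left₀ hx0.le (hx.2.le.trans hrR) 2
        have : d ≤ 1 := by
          have : 0 ≤ σ ^ 2 / (k : ℝ) ^ 2 := by positivity
          linarith
        gcongr
      have h4 : v x ^ pp k ε ≤ K * (d + x ^ 2 / (((k : ℝ) + 2) * k)) ^ (-((k : ℝ) + 4) / 2) :=
        h2.trans (mul_le_mul_of_nonneg_right h3 (by positivity))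
      have h5 := mul_le_mul_of_nonneg_left h4 (by positivity : 0 ≤ x ^ (k + 1))
      linarith)
  have : 0 ≤ K * (σ ^ (k + 2) * (d + σ ^ 2 / (((k : ℝ) + 2) * k)) ^ (-((k : ℝ) + 2) / 2) / ((k + 2) * d)) := by
    positivity
  simp only [h.v1σ] at m
  linarith

lemma v_low (h : Bub k ε σ ρ τ v v1) {r d R : ℝ} (hr : r ∈ Ioc σ ρ) (hrR : r ≤ R)
    (hd : d = 1 - σ ^ 2 / k ^ 2) (hd0 : 0 < d) :
    1 + (1 + R ^ 2 / ((k + 2) * k)) ^ (ε * k / 2) / d *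
      ((d + r ^ 2 / (((k : ℝ) + 2) * k)) ^ (-(k : ℝ) / 2) - d ^ (-(k : ℝ) / 2)) ≤ v r := by
  have hk := h.kpos
  have hσ := h.hσ
  have he := h.he
  set K := (1 + R ^ 2 / (((k : ℝ) + 2) * k)) ^ (ε * k / 2) with hK
  have hK0 : 0 < K := by positivity
  have hs : Icc σ r ⊆ Icc σ τ := Icc_subset_Icc le_rfl (hr.2.trans h.hρτ.le)
  have m := mono_aux (f := fun t => v t - K / d * (d + t ^ 2 / (((k : ℝ) + 2) * k)) ^ (-(k : ℝ) / 2))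
    (f' := fun t => v1 t - K / d * (-(t * (d + t ^ 2 / (((k : ℝ) + 2) * k)) ^ (-((k : ℝ) + 2) / 2) / (k + 2))))
    hr.1.le
    (by have := h.cv.mono hs
        have c2 : ContinuousOn (fun t : ℝ =>
          (d + t ^ 2 / (((k : ℝ) + 2) * k)) ^ (-(k : ℝ) / 2)) (Icc σ r) :=
          fun x _ => (dU1 h.hk hd0 x).continuousAt.continuousWithinAt
        fun_prop)
    (fun x hx => (h.dv x ⟨hx.1, hx.2.trans_le (hr.2.trans h.hρτ.le)⟩).sub
      ((dU1 h.hk hd0 x).const_mul (K / d)))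
    (fun x hx => by
      have hx0 := h.rpos hx.1
      have h1 := h.flux_up (R := R) ⟨hx.1, hx.2.trans_le hr.2⟩ (hx.2.le.trans hrR) hd hd0
      rw [← hK] at h1
      generalize (d + x ^ 2 / (((k : ℝ) + 2) * k)) ^ (-((k : ℝ) + 2) / 2) = z at h1 ⊢
      have e : v1 x - K / d * (-(x * z / ((k : ℝ) + 2))) =
        (K * (x ^ (k + 2) * z / ((k + 2) * d)) - -(x ^ (k + 1) * v1 x)) / x ^ (k + 1) := by
        field_simp; ring
      rw [e]
      apply div_nonneg _ (by positivity)
      linarith)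
  rw [h.vσ] at m
  have : (d + σ ^ 2 / (((k : ℝ) + 2) * k)) ^ (-(k : ℝ) / 2) ≤ d ^ (-(k : ℝ) / 2) := by
    apply Real.rpow_le_rpow_of_nonpos hd0
    · have : 0 ≤ σ ^ 2 / (((k : ℝ) + 2) * k) := by positivity
      linarith
    · rw [neg_div]; linarith
  have := mul_le_mul_of_nonneg_left this (by positivity : 0 ≤ K / d)
  rw [mul_sub]
  linarith

/-! tail region -/

lemma Phi_pos (h : Bub k ε σ ρ τ v v1) : 0 < -(ρ ^ (k + 1) * v1 ρ) := by
  have h1 := h.v1neg ρ ⟨h.hσρ, h.hρτ⟩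
  have := h.rpos h.hσρ
  have : 0 < ρ ^ (k + 1) * (- v1 ρ) := by
    have : 0 < - v1 ρ := by linarith
    positivity
  linarith

lemma subT (h : Bub k ε σ ρ τ v v1) {r : ℝ} (hr : r ≤ τ) : Icc ρ r ⊆ Icc σ τ :=
  Icc_subset_Icc h.hσρ.le hr

lemma fluxT (h : Bub k ε σ ρ τ v v1) {r : ℝ} (hr : r ∈ Icc ρ τ) :
    -(r ^ (k + 1) * v1 r) ≤ -(ρ ^ (k + 1) * v1 ρ) := by
  have m := mono_aux (f := fun r => r ^ (k + 1) * v1 r)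
    (f' := fun r => r ^ (k + 1) * (-v r) ^ pp k ε) hr.1
    (by have := h.cv1.mono (h.subT hr.2)
        fun_prop)
    (fun x hx => h.dfluxn ⟨hx.1, hx.2.trans_le hr.2⟩)
    (fun x hx => by
      have := h.rpos (h.hσρ.trans hx.1)
      have : 0 < - v x := neg_pos.2 (h.vneg x ⟨hx.1, hx.2.le.trans hr.2⟩)
      positivity)
  linarith

lemma dinv {k : ℕ} (hk : 1 ≤ k) {x : ℝ} (hx : 0 < x) (A : ℝ) :
    HasDerivAt (fun r : ℝ => A / k / r ^ k) (-(A / x ^ (k + 1))) x := by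
  have hk' : (0 : ℝ) < k := by exact_mod_cast hk
  have := (hasDerivAt_const x (A / (k : ℝ))).div (hasDerivAt_pow k x) (pow_ne_zero _ hx.ne')
  refine this.congr_deriv ?_
  obtain ⟨j, rfl⟩ : ∃ j, k = j + 1 := ⟨k - 1, by omega⟩
  simp only [Nat.add_sub_cancel]
  push_cast at hk' ⊢
  field_simp
  ring

lemma VT (h : Bub k ε σ ρ τ v v1) {r : ℝ} (hr : r ∈ Icc ρ τ) : -v r ≤ -(ρ * v1 ρ) / k := by
  have hk := h.kpos
  have hρ := h.rpos h.hσρ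
  have hP := h.Phi_pos
  set Φ := -(ρ ^ (k + 1) * v1 ρ) with hΦ
  have m := mono_aux (f := fun r => v r - Φ / k / r ^ k)
    (f' := fun r => v1 r - -(Φ / r ^ (k + 1))) hr.1
    (by have := h.cv.mono (h.subT hr.2)
        have : ContinuousOn (fun r : ℝ => Φ / k / r ^ k) (Icc ρ r) := fun x hx =>
          (dinv h.hk (hρ.trans_le hx.1) Φ).continuousAt.continuousWithinAt
        fun_prop)
    (fun x hx => (h.dv x ⟨h.hσρ.trans hx.1, hx.2.trans_le hr.2⟩).sub
      (dinv h.hk (hρ.trans hx.1) Φ))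
    (fun x hx => by
      have hx0 := hρ.trans hx.1
      have := h.fluxT ⟨hx.1.le, hx.2.le.trans hr.2⟩
      rw [← hΦ] at this
      have e : v1 x - -(Φ / x ^ (k + 1)) = (Φ - -(x ^ (k + 1) * v1 x)) / x ^ (k + 1) := by
        field_simp; ring
      rw [e]
      apply div_nonneg _ (by positivity)
      linarith)
  simp only [h.vρ] at m
  have hr0 := hρ.trans_le hr.1
  have h1 : 0 ≤ Φ / k / r ^ k := by positivity
  have h2 : Φ / k / ρ ^ k = -(ρ * v1 ρ) / k := by
    rw [hΦ]; field_simp; ring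
  linarith

lemma M0_pos (h : Bub k ε σ ρ τ v v1) : 0 < -(ρ * v1 ρ) / k := by
  have h1 := h.v1neg ρ ⟨h.hσρ, h.hρτ⟩
  have := h.rpos h.hσρ
  have hk := h.kpos
  have : 0 < ρ * (- v1 ρ) := by
    have : 0 < - v1 ρ := by linarith
    positivity
  apply div_pos _ hk
  linarith

lemma fluxT_low (h : Bub k ε σ ρ τ v v1) {r : ℝ} (hr : r ∈ Icc ρ τ) :
    -(ρ ^ (k + 1) * v1 ρ) - (-(ρ * v1 ρ) / k) ^ pp k ε * r ^ (k + 2) / (k + 2) ≤ -(r ^ (k + 1) * v1 r) := by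
  have hp := pp_gt1 h.hk h.hek
  have hk := h.kpos
  have hρ := h.rpos h.hσρ
  have hM := h.M0_pos
  have hVT : ∀ r ∈ Icc ρ τ, -v r ≤ -(ρ * v1 ρ) / k := fun r hr => h.VT hr
  set M0 := -(ρ * v1 ρ) / k
  have m := mono_aux (f := fun r => M0 ^ pp k ε * r ^ (k + 2) / (k + 2) - r ^ (k + 1) * v1 r)
    (f' := fun r => r ^ (k + 1) * (M0 ^ pp k ε - (-v r) ^ pp k ε)) hr.1
    (by have := h.cv1.mono (h.subT hr.2)
        fun_prop)
    (fun x hx => by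
      refine ((((hasDerivAt_pow (k + 2) x).const_mul (M0 ^ pp k ε)).div_const ((k : ℝ) + 2)).sub
        (h.dfluxn ⟨hx.1, hx.2.trans_le hr.2⟩)).congr_deriv ?_
      push_cast
      field_simp)
    (fun x hx => by
      have hx0 := hρ.trans hx.1
      have h0 : 0 < - v x := neg_pos.2 (h.vneg x ⟨hx.1, hx.2.le.trans hr.2⟩)
      have := Real.rpow_le_rpow h0.le (hVT x ⟨hx.1.le, hx.2.le.trans hr.2⟩) (by linarith : 0 ≤ pp k ε)
      apply mul_nonneg (by positivity)
      linarith)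
  have : 0 ≤ M0 ^ pp k ε * ρ ^ (k + 2) / (k + 2) := by positivity
  linarith

lemma VT_low (h : Bub k ε σ ρ τ v v1) {K : ℝ} (hK : 1 ≤ K)
    (hKη : K ^ (k + 2) * ((-(ρ * v1 ρ) / k) ^ (pp k ε - 1) * ρ ^ 2) ≤ (k + 2) * k) :
    (-(ρ * v1 ρ) / k) * (1 - 1 / K ^ k -
      ((-(ρ * v1 ρ) / k) ^ (pp k ε - 1) * ρ ^ 2) * K ^ 2 / (2 * (k + 2))) ≤ - v τ := by
  have hp := pp_gt1 h.hk h.hek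
  have hk := h.kpos
  have hρ := h.rpos h.hσρ
  have hM := h.M0_pos
  have hfl : ∀ r ∈ Icc ρ τ, _ := fun r hr => h.fluxT_low hr
  have eΦ : -(ρ ^ (k + 1) * v1 ρ) = k * ρ ^ k * (-(ρ * v1 ρ) / k) := by field_simp; ring
  rw [eΦ] at hfl
  set M0 := -(ρ * v1 ρ) / k
  have eM : M0 ^ pp k ε = M0 ^ (pp k ε - 1) * M0 := by
    rw [← Real.rpow_add_one hM.ne']; congr 1; ring
  rw [eM] at hfl
  have hA : 0 < M0 ^ (pp k ε - 1) := by positivity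
  set A := M0 ^ (pp k ε - 1)
  have hτ : 0 < τ := hρ.trans h.hρτ
  have hKτ : K * ρ ≤ τ := by
    by_contra! hc
    have h1 := hfl τ ⟨h.hρτ.le, le_rfl⟩
    rw [h.v1τ] at h1
    have h2 : τ ^ (k + 2) < (K * ρ) ^ (k + 2) := pow_lt_pow_left₀ hc hτ.le (by omega)
    have h3 : A * M0 * τ ^ (k + 2) / (k + 2) < k * ρ ^ k * M0 := by
      rw [div_lt_iff₀ (by positivity)]
      have : A * M0 * τ ^ (k + 2) < A * M0 * (K * ρ) ^ (k + 2) :=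
        mul_lt_mul_of_pos_left h2 (by positivity)
      have h5 := mul_le_mul_of_nonneg_left hKη (by positivity : 0 ≤ M0 * ρ ^ k)
      have e : A * M0 * (K * ρ) ^ (k + 2) = M0 * ρ ^ k * (K ^ (k + 2) * (A * ρ ^ 2)) := by ring
      linarith
    linarith
  have hmem : ρ ≤ K * ρ := by nlinarith
  have m := mono_aux (f := fun r => - v r + (k * ρ ^ k * M0) / k / r ^ k + A * M0 * r ^ 2 / (2 * (k + 2)))
    (f' := fun r => - v1 r + -((k * ρ ^ k * M0) / r ^ (k + 1)) + A * M0 * (2 * r) / (2 * (k + 2))) hmem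
    (by have := h.cv.mono (h.subT hKτ)
        have : ContinuousOn (fun r : ℝ => (k * ρ ^ k * M0) / k / r ^ k) (Icc ρ (K * ρ)) := fun x hx =>
          (dinv h.hk (hρ.trans_le hx.1) (k * ρ ^ k * M0)).continuousAt.continuousWithinAt
        fun_prop)
    (fun x hx => by
      refine (((h.dv x ⟨h.hσρ.trans hx.1, hx.2.trans_le hKτ⟩).neg.add
        (dinv h.hk (hρ.trans hx.1) (k * ρ ^ k * M0))).add
        (((hasDerivAt_pow 2 x).const_mul (A * M0)).div_const (2 * ((k : ℝ) + 2)))).congr_deriv ?_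
      push_cast
      ring)
    (fun x hx => by
      have hx0 := hρ.trans hx.1
      have := hfl x ⟨hx.1.le, hx.2.le.trans hKτ⟩
      have e : - v1 x + -((k * ρ ^ k * M0) / x ^ (k + 1)) + A * M0 * (2 * x) / (2 * ((k : ℝ) + 2))
        = (-(x ^ (k + 1) * v1 x) - (k * ρ ^ k * M0 - A * M0 * x ^ (k + 2) / (k + 2))) / x ^ (k + 1) := by
        field_simp; ring
      rw [e]
      apply div_nonneg _ (by positivity)
      linarith)
  simp only [h.vρ] at m
  have h1 := h.anti (h.hσρ.le.trans hmem) hKτ le_rfl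
  have hK0 : 0 < K := by linarith
  have e1 : k * ρ ^ k * M0 / k / ρ ^ k = M0 := by field_simp
  have e2 : k * ρ ^ k * M0 / k / (K * ρ) ^ k = M0 * (1 / K ^ k) := by
    rw [mul_pow]; field_simp
  have e3 : A * M0 * (K * ρ) ^ 2 / (2 * ((k : ℝ) + 2)) = M0 * (A * ρ ^ 2 * K ^ 2 / (2 * (k + 2))) := by ring
  have e4 : 0 ≤ A * M0 * ρ ^ 2 / (2 * ((k : ℝ) + 2)) := by positivity
  rw [e1, e2, e3] at m
  rw [mul_sub, mul_sub]
  linarith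

lemma aa_pos (h : Bub k ε σ ρ τ v v1) : 0 < aa k ε := by
  have hp := pp_gt1 h.hk h.hek
  have hk := h.kpos
  have he := h.he
  have : 0 < pp k ε + 1 := by linarith
  unfold aa; positivity

lemma PT (h : Bub k ε σ ρ τ v v1) : PP k ε v v1 ρ ≤ PP k ε v v1 τ ∧
    PP k ε v v1 τ ≤ PP k ε v v1 ρ + aa k ε * ((- v τ) * -(ρ ^ (k + 1) * v1 ρ)) := by
  have ha := h.aa_pos
  have hρ := h.rpos h.hσρ
  have hM : 0 < - v τ := neg_pos.2 (h.vneg τ ⟨h.hρτ, le_rfl⟩)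
  constructor
  · exact mono_aux h.hρτ.le (h.cP.mono (h.subT le_rfl)) (fun x hx => h.dPn hx)
      (fun x hx => by
        have := hρ.trans hx.1
        have : 0 < - v x := neg_pos.2 (h.vneg x ⟨hx.1, hx.2.le⟩)
        positivity)
  · have m := mono_aux (f := fun x => aa k ε * ((- v τ) * (x ^ (k + 1) * v1 x)) - PP k ε v v1 x)
      (f' := fun r => aa k ε * ((- v τ) * (r ^ (k + 1) * (-v r) ^ pp k ε)) -
        aa k ε * (r ^ (k + 1) * (-v r) ^ (pp k ε + 1))) h.hρτ.le
      (by have c1 := h.cP.mono (h.subT le_rfl)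
          have c2 := h.cv1.mono (h.subT le_rfl)
          fun_prop)
      (fun x hx => (((h.dfluxn hx).const_mul (- v τ)).const_mul (aa k ε)).sub (h.dPn hx))
      (fun x hx => by
        have := hρ.trans hx.1
        have h0 : 0 < - v x := neg_pos.2 (h.vneg x ⟨hx.1, hx.2.le⟩)
        have h1 := h.anti (h.hσρ.trans hx.1).le hx.2.le le_rfl
        rw [Real.rpow_add_one h0.ne']
        have e : aa k ε * ((- v τ) * (x ^ (k + 1) * (-v x) ^ pp k ε)) -
          aa k ε * (x ^ (k + 1) * ((-v x) ^ pp k ε * (- v x))) =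
          aa k ε * (x ^ (k + 1) * (-v x) ^ pp k ε) * (v x - v τ) := by ring
        rw [e]
        apply mul_nonneg (by positivity)
        linarith)
    simp only [h.v1τ] at m
    linarith

lemma Pσ (h : Bub k ε σ ρ τ v v1) : PP k ε v v1 σ = σ ^ (k + 2) / (pp k ε + 1) := by
  unfold PP; simp [h.v1σ, h.vσ]; ring

lemma Pρ (h : Bub k ε σ ρ τ v v1) : PP k ε v v1 ρ = ρ ^ (k + 2) * v1 ρ ^ 2 / 2 := by
  have hp := pp_gt1 h.hk h.hek
  unfold PP; simp only [h.vρ, abs_zero]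
  rw [Real.zero_rpow (by linarith)]; ring

lemma Pτ (h : Bub k ε σ ρ τ v v1) :
    PP k ε v v1 τ = τ ^ (k + 2) * (- v τ) ^ (pp k ε + 1) / (pp k ε + 1) := by
  unfold PP; rw [h.v1τ, abs_of_neg (h.vneg τ ⟨h.hρτ, le_rfl⟩)]; ring

end Bub


lemma beta_real {α : ℝ} (hα : 0 < α) :
    ∫ x in Ioo (0 : ℝ) 1, x ^ (α - 1) * (1 - x) ^ (α - 1) =
      Real.Gamma α ^ 2 / Real.Gamma (2 * α) := by
  have h := ProbabilityTheory.beta_eq_betaIntegralReal α α hα hα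
  unfold ProbabilityTheory.beta at h
  rw [two_mul, sq, h, Complex.betaIntegral]
  have : ∫ x in (0 : ℝ)..1, (x : ℂ) ^ ((α : ℂ) - 1) * (1 - (x : ℂ)) ^ ((α : ℂ) - 1) =
      ∫ x in (0 : ℝ)..1, ((x ^ (α - 1) * (1 - x) ^ (α - 1) : ℝ) : ℂ) := by
    apply intervalIntegral.integral_congr
    intro x hx
    rw [uIcc_of_le zero_le_one] at hx
    have h1 : 0 ≤ 1 - x := by linarith [hx.2]
    simp only []
    push_cast
    rw [Complex.ofReal_cpow hx.1, Complex.ofReal_cpow h1]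
    push_cast
    rfl
  rw [this, intervalIntegral.integral_ofReal, Complex.ofReal_re,
    intervalIntegral.integral_of_le zero_le_one, integral_Ioc_eq_integral_Ioo]

lemma E_const {k : ℕ} (hk : 1 ≤ k) :
    ∫ t in Ioi (0 : ℝ), t ^ (k + 1) * (1 + t ^ 2 / (((k : ℝ) + 2) * k)) ^ (-((k : ℝ) + 2)) =
    (((k : ℝ) + 2) * k) ^ (((k : ℝ) + 2) / 2) / 2 *
      (Real.Gamma (((k : ℝ) + 2) / 2) ^ 2 / Real.Gamma ((k : ℝ) + 2)) := by
  have hk' : (0 : ℝ) < k := by exact_mod_cast hk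
  have hc : 0 < ((k : ℝ) + 2) * k := by positivity
  set c := ((k : ℝ) + 2) * k
  have hb := beta_real (α := ((k : ℝ) + 2) / 2) (by positivity)
  have e1 : 2 * (((k : ℝ) + 2) / 2) = k + 2 := by ring
  rw [e1] at hb
  have himg : (fun t : ℝ => t ^ 2 / (c + t ^ 2)) '' Ioi 0 = Ioo 0 1 := by
    ext x
    constructor
    · rintro ⟨t, ht, rfl⟩
      have ht' : (0 : ℝ) < t := ht
      refine ⟨by positivity, ?_⟩
      simp only
      rw [div_lt_one (by positivity)]; linarith
    · rintro ⟨h0, h1⟩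
      have h2 : 0 < 1 - x := by linarith
      refine ⟨Real.sqrt (c * x / (1 - x)), Real.sqrt_pos.2 (by positivity), ?_⟩
      simp only
      rw [Real.sq_sqrt (by positivity)]
      field_simp
      ring
  have hmono : MonotoneOn (fun t : ℝ => t ^ 2 / (c + t ^ 2)) (Ioi 0) := by
    intro a ha b hb hab
    have ha' : (0 : ℝ) < a := ha
    have hb' : (0 : ℝ) < b := hb
    simp only
    rw [div_le_div_iff₀ (by positivity) (by positivity)]
    have : a ^ 2 ≤ b ^ 2 := pow_le_pow_left₀ ha'.le hab 2
    nlinarith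
  have hcv := integral_image_eq_integral_deriv_smul_of_monotoneOn (s := Ioi (0 : ℝ))
    (f := fun t : ℝ => t ^ 2 / (c + t ^ 2)) (f' := fun t => 2 * c * t / (c + t ^ 2) ^ 2)
    measurableSet_Ioi
    (fun t ht => by
      have ht' : (0 : ℝ) < t := ht
      have := (hasDerivAt_pow 2 t).div ((hasDerivAt_pow 2 t).const_add c) (by positivity)
      refine (this.congr_deriv ?_).hasDerivWithinAt
      push_cast
      field_simp
      ring)
    hmono (fun x => x ^ (((k : ℝ) + 2) / 2 - 1) * (1 - x) ^ (((k : ℝ) + 2) / 2 - 1))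
  rw [himg, hb] at hcv
  rw [hcv, ← integral_const_mul]
  apply setIntegral_congr_fun measurableSet_Ioi
  intro t ht
  have ht' : (0 : ℝ) < t := ht
  simp only [smul_eq_mul]
  have e2 : 1 - t ^ 2 / (c + t ^ 2) = c / (c + t ^ 2) := by field_simp; ring
  have e3 : ((k : ℝ) + 2) / 2 - 1 = k / 2 := by ring
  have hct : 0 < c + t ^ 2 := by positivity
  rw [e2, e3, ← Real.mul_rpow (by positivity) (by positivity)]
  have e4 : t ^ 2 / (c + t ^ 2) * (c / (c + t ^ 2)) = (t / (c + t ^ 2)) ^ 2 * c := by field_simp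
  have e5 : ((t / (c + t ^ 2)) ^ 2) ^ ((k : ℝ) / 2) = (t / (c + t ^ 2)) ^ k := by
    have hq : 0 ≤ t / (c + t ^ 2) := by positivity
    generalize t / (c + t ^ 2) = q at hq
    rw [← Real.rpow_natCast q 2, ← Real.rpow_mul hq, ← Real.rpow_natCast q k]
    congr 1; push_cast; ring
  rw [e4, Real.mul_rpow (by positivity) hc.le, e5]
  have e6 : (1 + t ^ 2 / c) ^ (-((k : ℝ) + 2)) = (c / (c + t ^ 2)) ^ (k + 2) := by
    rw [Real.rpow_neg (by positivity), ← Real.inv_rpow (by positivity)]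
    have : ((k : ℝ) + 2) = ((k + 2 : ℕ) : ℝ) := by push_cast; ring
    rw [this, Real.rpow_natCast]
    congr 1
    field_simp
  have e7 : c ^ (((k : ℝ) + 2) / 2) * c ^ ((k : ℝ) / 2) = c ^ (k + 1) := by
    rw [← Real.rpow_add hc, ← Real.rpow_natCast]
    congr 1; push_cast; ring
  rw [e6]
  have e8 : c ^ (((k : ℝ) + 2) / 2) / 2 * (2 * c * t / (c + t ^ 2) ^ 2 *
     ((t / (c + t ^ 2)) ^ k * c ^ ((k : ℝ) / 2))) =
     (c ^ (((k : ℝ) + 2) / 2) * c ^ ((k : ℝ) / 2)) * (c * t / (c + t ^ 2) ^ 2 * (t / (c + t ^ 2)) ^ k) := by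
    ring
  rw [e8, e7, div_pow, div_pow]
  field_simp
  ring

lemma F_const {k : ℕ} (hk : 1 ≤ k) :
    ∫ t in Ioi (0 : ℝ), t ^ (k + 1) * (1 + t ^ 2 / (((k : ℝ) + 2) * k)) ^ (-((k : ℝ) + 4) / 2) =
    (((k : ℝ) + 2) * k) ^ (((k : ℝ) + 2) / 2) / (k + 2) := by
  have hk' : (0 : ℝ) < k := by exact_mod_cast hk
  have hc : 0 < ((k : ℝ) + 2) * k := by positivity
  have := integral_Ioi_of_hasDerivAt_of_nonneg' (a := 0)
    (l := (((k : ℝ) + 2) * k) ^ (((k : ℝ) + 2) / 2) / (k + 2))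
    (fun x _ => dU2 hk one_pos x)
    (fun x hx => by
      have : (0 : ℝ) < x := hx
      positivity)
    (by
      have h1 : Tendsto (fun t : ℝ => ((t ^ 2)⁻¹ + (((k : ℝ) + 2) * k)⁻¹) ^ (-((k : ℝ) + 2) / 2) / (k + 2)) atTop
        (𝓝 ((0 + (((k : ℝ) + 2) * k)⁻¹) ^ (-((k : ℝ) + 2) / 2) / (k + 2))) := by
        apply Tendsto.div_const
        apply Tendsto.rpow_const
        · apply Tendsto.add_const
          exact tendsto_inv_atTop_zero.comp (tendsto_pow_atTop two_ne_zero)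
        · left; positivity
      rw [zero_add, Real.inv_rpow hc.le, ← Real.rpow_neg hc.le, neg_div, neg_neg] at h1
      refine h1.congr' ?_
      filter_upwards [eventually_gt_atTop 0] with t ht
      have e : (t ^ 2)⁻¹ + (((k : ℝ) + 2) * k)⁻¹ = (1 + t ^ 2 / (((k : ℝ) + 2) * k)) * (t ^ 2)⁻¹ := by
        field_simp
      have e2 : ((t ^ 2)⁻¹) ^ (-(((k : ℝ) + 2) / 2)) = t ^ (k + 2) := by
        rw [Real.inv_rpow (by positivity), Real.rpow_neg (by positivity), inv_inv,
          ← Real.rpow_natCast _ 2, ← Real.rpow_mul ht.le, ← Real.rpow_natCast]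
        congr 1; push_cast; ring
      rw [e, Real.mul_rpow (by positivity) (by positivity), e2, mul_one, neg_div, mul_comm])
  rw [this]
  simp

lemma dom_bound {k : ℕ} (hk : 1 ≤ k) {t : ℝ} (ht : 0 < t) :
    t ^ (k + 1) * (1 / 2 + t ^ 2 / (((k : ℝ) + 2) * k)) ^ (-((k : ℝ) + 3) / 2) ≤
    (((k : ℝ) + 2) * k) ^ (((k : ℝ) + 1) / 2) * (((k : ℝ) + 2) * k) * (1 + t ^ 2)⁻¹ := by
  have hk' : (1 : ℝ) ≤ k := by exact_mod_cast hk
  have hc : 3 ≤ ((k : ℝ) + 2) * k := by nlinarith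
  set c := ((k : ℝ) + 2) * k
  have hc0 : 0 < c := by linarith
  set B := 1 / 2 + t ^ 2 / c with hB
  have hB0 : 0 < B := by positivity
  have e1 : t ^ (k + 1) = (t ^ 2) ^ (((k : ℝ) + 1) / 2) := by
    rw [← Real.rpow_natCast _ 2, ← Real.rpow_mul ht.le, ← Real.rpow_natCast]
    congr 1; push_cast; ring
  have h1 : t ^ 2 ≤ c * B := by
    rw [hB]; field_simp; linarith
  have h2 : (t ^ 2) ^ (((k : ℝ) + 1) / 2) ≤ (c * B) ^ (((k : ℝ) + 1) / 2) :=
    Real.rpow_le_rpow (by positivity) h1 (by positivity)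
  have e2 : B ^ (((k : ℝ) + 1) / 2) * B ^ (-((k : ℝ) + 3) / 2) = B⁻¹ := by
    rw [← Real.rpow_add hB0, ← Real.rpow_neg_one]; congr 1; ring
  have h3 : B⁻¹ ≤ c * (1 + t ^ 2)⁻¹ := by
    rw [← div_eq_mul_inv, inv_eq_one_div, div_le_div_iff₀ hB0 (by positivity), hB]
    field_simp; nlinarith
  calc _ ≤ (c * B) ^ (((k : ℝ) + 1) / 2) * B ^ (-((k : ℝ) + 3) / 2) := by
        rw [e1]; gcongr
    _ = c ^ (((k : ℝ) + 1) / 2) * B⁻¹ := by rw [Real.mul_rpow hc0.le hB0.le, mul_assoc, e2]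
    _ ≤ c ^ (((k : ℝ) + 1) / 2) * (c * (1 + t ^ 2)⁻¹) := by gcongr
    _ = _ := by ring

section fam
variable {k : ℕ} {σ ρ τ : ℝ → ℝ} {v v1 : ℝ → ℝ → ℝ}

lemma fam_d (hσ : Tendsto σ (𝓝[>] 0) (𝓝 0)) :
    Tendsto (fun ε => 1 - σ ε ^ 2 / (k : ℝ) ^ 2) (𝓝[>] 0) (𝓝 1) := by
  have := ((hσ.pow 2).div_const ((k : ℝ) ^ 2)).const_sub 1
  simpa using this

lemma fam_id : Tendsto (fun ε : ℝ => ε) (𝓝[>] 0) (𝓝 0) :=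
  tendsto_id.mono_left nhdsWithin_le_nhds

lemma fam_low (hk : 1 ≤ k) (hσ : Tendsto σ (𝓝[>] 0) (𝓝 0)) (R : ℝ) :
    Tendsto (fun ε : ℝ => 1 + (1 + R ^ 2 / (((k : ℝ) + 2) * k)) ^ (ε * k / 2) / (1 - σ ε ^ 2 / (k : ℝ) ^ 2) *
      (((1 - σ ε ^ 2 / (k : ℝ) ^ 2) + R ^ 2 / (((k : ℝ) + 2) * k)) ^ (-(k : ℝ) / 2)
        - (1 - σ ε ^ 2 / (k : ℝ) ^ 2) ^ (-(k : ℝ) / 2))) (𝓝[>] 0)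
      (𝓝 ((1 + R ^ 2 / (((k : ℝ) + 2) * k)) ^ (-(k : ℝ) / 2))) := by
  have hd := fam_d (k := k) hσ
  have hk' : (0 : ℝ) < k := by exact_mod_cast hk
  have hb : 0 < 1 + R ^ 2 / (((k : ℝ) + 2) * k) := by positivity
  have h1 : Tendsto (fun ε : ℝ => (1 + R ^ 2 / (((k : ℝ) + 2) * k)) ^ (ε * k / 2)) (𝓝[>] 0)
      (𝓝 ((1 + R ^ 2 / (((k : ℝ) + 2) * k)) ^ ((0 : ℝ) * k / 2))) :=
    tendsto_const_nhds.rpow ((fam_id.mul_const _).div_const _) (Or.inl hb.ne')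
  have h2 := (hd.add_const (R ^ 2 / (((k : ℝ) + 2) * k))).rpow_const (p := -(k : ℝ) / 2) (Or.inl hb.ne')
  have h3 := hd.rpow_const (p := -(k : ℝ) / 2) (Or.inl one_ne_zero)
  have := ((h1.div hd one_ne_zero).mul (h2.sub h3)).const_add 1
  simpa using this

lemma fam_rho (hk : 1 ≤ k) (hσ : Tendsto σ (𝓝[>] 0) (𝓝 0))
    (h : ∀ᶠ ε in 𝓝[>] (0 : ℝ), Bub k ε (σ ε) (ρ ε) (τ ε) (v ε) (v1 ε)) :
    Tendsto ρ (𝓝[>] 0) atTop := by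
  rw [tendsto_atTop]
  intro R0
  set R := max R0 1
  have hd := fam_d (k := k) hσ
  have hl := fam_low hk hσ R
  have hb : 0 < (1 + R ^ 2 / (((k : ℝ) + 2) * k)) ^ (-(k : ℝ) / 2) := by positivity
  filter_upwards [h, hl.eventually (lt_mem_nhds hb), hd.eventually (lt_mem_nhds one_pos)] with ε h h1 h2
  by_contra! hc
  have hR : ρ ε ≤ R := hc.le.trans (le_max_left _ _)
  have h3 := h.v_low (R := R) ⟨h.hσρ, le_rfl⟩ hR rfl h2
  rw [h.vρ] at h3
  have hk' := h.kpos
  have hρ := h.rpos h.hσρ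
  have h4 : ((1 - σ ε ^ 2 / (k : ℝ) ^ 2) + R ^ 2 / (((k : ℝ) + 2) * k)) ^ (-(k : ℝ) / 2) ≤
    ((1 - σ ε ^ 2 / (k : ℝ) ^ 2) + ρ ε ^ 2 / (((k : ℝ) + 2) * k)) ^ (-(k : ℝ) / 2) := by
    apply Real.rpow_le_rpow_of_nonpos
    · positivity
    · have : ρ ε ^ 2 ≤ R ^ 2 := pow_le_pow_left₀ hρ.le hR 2
      gcongr
    · rw [neg_div]; linarith
  have h5 := mul_le_mul_of_nonneg_left h4 (by positivity : 0 ≤ (1 + R ^ 2 / (((k : ℝ) + 2) * k)) ^ (ε * k / 2) / (1 - σ ε ^ 2 / (k : ℝ) ^ 2))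
  rw [mul_sub] at h1 h3
  linarith

lemma fam_v (hk : 1 ≤ k) (hσ : Tendsto σ (𝓝[>] 0) (𝓝 0))
    (h : ∀ᶠ ε in 𝓝[>] (0 : ℝ), Bub k ε (σ ε) (ρ ε) (τ ε) (v ε) (v1 ε)) {R : ℝ} (hR : 0 < R) :
    Tendsto (fun ε => v ε R) (𝓝[>] 0) (𝓝 ((1 + R ^ 2 / (((k : ℝ) + 2) * k)) ^ (-(k : ℝ) / 2))) := by
  have hd := fam_d (k := k) hσ
  have hl := fam_low hk hσ R
  have hρ := fam_rho hk hσ h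
  have hb : 0 < 1 + R ^ 2 / (((k : ℝ) + 2) * k) := by positivity
  have hu := (hd.add_const (R ^ 2 / (((k : ℝ) + 2) * k))).rpow_const (p := -(k : ℝ) / 2) (Or.inl hb.ne')
  refine tendsto_of_tendsto_of_tendsto_of_le_of_le' hl hu ?_ ?_
  · filter_upwards [h, hρ.eventually_gt_atTop R, hσ.eventually (gt_mem_nhds hR),
      hd.eventually (lt_mem_nhds one_pos)] with ε h h1 h2 h3
    exact h.v_low ⟨h2, h1.le⟩ le_rfl rfl h3
  · filter_upwards [h, hρ.eventually_gt_atTop R, hσ.eventually (gt_mem_nhds hR),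
      hd.eventually (lt_mem_nhds one_pos)] with ε h h1 h2 h3
    exact h.v_up ⟨h2, h1⟩ rfl h3

lemma fam_int (hk : 1 ≤ k) (hσ : Tendsto σ (𝓝[>] 0) (𝓝 0))
    (h : ∀ᶠ ε in 𝓝[>] (0 : ℝ), Bub k ε (σ ε) (ρ ε) (τ ε) (v ε) (v1 ε)) {q : ℝ → ℝ} {q0 : ℝ}
    (hq : Tendsto q (𝓝[>] 0) (𝓝 q0)) (hq1 : ∀ᶠ ε in 𝓝[>] (0 : ℝ), 1 + 3 / (k : ℝ) ≤ q ε) :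
    Tendsto (fun ε => ∫ t in (σ ε)..(ρ ε), t ^ (k + 1) * v ε t ^ q ε) (𝓝[>] 0)
      (𝓝 (∫ t in Ioi (0 : ℝ), t ^ (k + 1) *
        ((1 + t ^ 2 / (((k : ℝ) + 2) * k)) ^ (-(k : ℝ) / 2)) ^ q0)) := by
  have hd := fam_d (k := k) hσ
  have hρ := fam_rho hk hσ h
  have hk' : (0 : ℝ) < k := by exact_mod_cast hk
  have hlim := tendsto_integral_filter_of_dominated_convergence (μ := volume.restrict (Ioi (0 : ℝ)))
    (l := 𝓝[>] (0 : ℝ))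
    (F := fun ε => (Ioo (σ ε) (ρ ε)).indicator (fun t => t ^ (k + 1) * v ε t ^ q ε))
    (f := fun t => t ^ (k + 1) * ((1 + t ^ 2 / (((k : ℝ) + 2) * k)) ^ (-(k : ℝ) / 2)) ^ q0)
    (fun t => (((k : ℝ) + 2) * k) ^ (((k : ℝ) + 1) / 2) * (((k : ℝ) + 2) * k) * (1 + t ^ 2)⁻¹)
    ?_ ?_ ?_ ?_
  · refine hlim.congr' ?_
    filter_upwards [h] with ε h
    rw [integral_indicator measurableSet_Ioo, Measure.restrict_restrict measurableSet_Ioo,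
      inter_eq_left.2 (show Ioo (σ ε) (ρ ε) ⊆ Ioi 0 from fun x hx => h.rpos hx.1), intervalIntegral.integral_of_le h.hσρ.le,
      integral_Ioc_eq_integral_Ioo]
  · filter_upwards [h] with ε h
    rw [aestronglyMeasurable_indicator_iff measurableSet_Ioo, Measure.restrict_restrict measurableSet_Ioo,
      inter_eq_left.2 (show Ioo (σ ε) (ρ ε) ⊆ Ioi 0 from fun x hx => h.rpos hx.1)]
    apply ContinuousOn.aestronglyMeasurable _ measurableSet_Ioo
    have c1 : ContinuousOn (fun t => v ε t ^ q ε) (Ioo (σ ε) (ρ ε)) :=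
      (h.cv.mono (fun x hx => ⟨hx.1.le, (hx.2.trans h.hρτ).le⟩)).rpow_const
        (fun x hx => Or.inl (h.vpos x ⟨hx.1.le, hx.2⟩).ne')
    fun_prop
  · filter_upwards [h, hq1, hd.eventually (lt_mem_nhds (by norm_num : (1 / 2 : ℝ) < 1))] with ε h h1 h2
    filter_upwards [ae_restrict_mem measurableSet_Ioi] with t ht
    have ht0 : (0 : ℝ) < t := ht
    by_cases hm : t ∈ Ioo (σ ε) (ρ ε)
    · rw [indicator_of_mem hm]
      have hv := h.vpos t ⟨hm.1.le, hm.2⟩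
      rw [Real.norm_of_nonneg (by positivity)]
      refine le_trans ?_ (dom_bound hk ht0)
      apply mul_le_mul_of_nonneg_left _ (by positivity)
      have hb : 0 < (1 / 2 : ℝ) + t ^ 2 / (((k : ℝ) + 2) * k) := by positivity
      have hvu := h.v_up hm rfl (by linarith)
      have h3 : v ε t ≤ (1 / 2 + t ^ 2 / (((k : ℝ) + 2) * k)) ^ (-(k : ℝ) / 2) := by
        refine hvu.trans ?_
        apply Real.rpow_le_rpow_of_nonpos hb
        · linarith
        · rw [neg_div]; linarith
      calc v ε t ^ q ε ≤ v ε t ^ (1 + 3 / (k : ℝ)) :=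
            Real.rpow_le_rpow_of_exponent_ge hv (h.vle1 hm.1.le (hm.2.trans h.hρτ).le) h1
        _ ≤ ((1 / 2 + t ^ 2 / (((k : ℝ) + 2) * k)) ^ (-(k : ℝ) / 2)) ^ (1 + 3 / (k : ℝ)) :=
            Real.rpow_le_rpow hv.le h3 (by positivity)
        _ = _ := by
            rw [← Real.rpow_mul hb.le]
            congr 1
            field_simp
    · rw [indicator_of_notMem hm]
      simp only [norm_zero]
      positivity
  · exact (integrable_inv_one_add_sq.const_mul _).integrableOn
  · filter_upwards [ae_restrict_mem measurableSet_Ioi] with t ht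
    have ht0 : (0 : ℝ) < t := ht
    have hb : 0 < (1 + t ^ 2 / (((k : ℝ) + 2) * k)) ^ (-(k : ℝ) / 2) := by positivity
    have := ((fam_v hk hσ h ht0).rpow hq (Or.inl hb.ne')).const_mul (t ^ (k + 1))
    refine this.congr' ?_
    filter_upwards [hρ.eventually_gt_atTop t, hσ.eventually (gt_mem_nhds ht0)] with ε h1 h2
    rw [indicator_of_mem (show t ∈ Ioo (σ ε) (ρ ε) from ⟨h2, h1⟩)]

lemma pp_lim (k : ℕ) : Tendsto (fun ε => pp k ε) (𝓝[>] 0) (𝓝 (((k : ℝ) + 4) / k)) := by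
  have := (fam_id.const_sub (((k : ℝ) + 4) / k))
  simpa [pp] using this

lemma fam_Phi (hk : 1 ≤ k) (hσ : Tendsto σ (𝓝[>] 0) (𝓝 0))
    (h : ∀ᶠ ε in 𝓝[>] (0 : ℝ), Bub k ε (σ ε) (ρ ε) (τ ε) (v ε) (v1 ε)) :
    Tendsto (fun ε => -(ρ ε ^ (k + 1) * v1 ε (ρ ε))) (𝓝[>] 0)
      (𝓝 ((((k : ℝ) + 2) * k) ^ (((k : ℝ) + 2) / 2) / (k + 2))) := by
  have hk' : (0 : ℝ) < k := by exact_mod_cast hk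
  have hi := fam_int hk hσ h (pp_lim k) (h.mono (fun ε h => pp_gt h.hk h.hek))
  have e : ∀ t : ℝ, ((1 + t ^ 2 / (((k : ℝ) + 2) * k)) ^ (-(k : ℝ) / 2)) ^ (((k : ℝ) + 4) / k) =
     (1 + t ^ 2 / (((k : ℝ) + 2) * k)) ^ (-((k : ℝ) + 4) / 2) := by
    intro t
    rw [← Real.rpow_mul (by positivity)]
    congr 1; field_simp
  simp_rw [e] at hi
  rw [F_const hk] at hi
  refine hi.congr' ?_
  filter_upwards [h] with ε h
  have hp := pp_gt1 h.hk h.hek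
  have hs : Icc (σ ε) (ρ ε) ⊆ Icc (σ ε) (τ ε) := Icc_subset_Icc le_rfl h.hρτ.le
  have c0 := h.cv.mono hs
  have c1 := h.cv1.mono hs
  have := intervalIntegral.integral_eq_sub_of_hasDerivAt_of_le h.hσρ.le
    (f := fun r => -(r ^ (k + 1) * v1 ε r)) (f' := fun r => r ^ (k + 1) * v ε r ^ pp k ε)
    (by fun_prop) (fun x hx => ((h.dfluxp hx).neg).congr_deriv (by ring))
    (by
      apply ContinuousOn.intervalIntegrable
      rw [uIcc_of_le h.hσρ.le]
      have : ContinuousOn (fun r => v ε r ^ pp k ε) (Icc (σ ε) (ρ ε)) :=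
        c0.rpow_const (fun x _ => Or.inr (by linarith))
      fun_prop)
  rw [this]
  simp [h.v1σ]

/-- `E` -/
def EE (k : ℕ) : ℝ := (((k : ℝ) + 2) * k) ^ (((k : ℝ) + 2) / 2) / 2 *
      (Real.Gamma (((k : ℝ) + 2) / 2) ^ 2 / Real.Gamma ((k : ℝ) + 2))

lemma fam_P1 (hk : 1 ≤ k) (hσ : Tendsto σ (𝓝[>] 0) (𝓝 0))
    (h : ∀ᶠ ε in 𝓝[>] (0 : ℝ), Bub k ε (σ ε) (ρ ε) (τ ε) (v ε) (v1 ε)) :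
    Tendsto (fun ε => (PP k ε (v ε) (v1 ε) (ρ ε) - PP k ε (v ε) (v1 ε) (σ ε)) / aa k ε) (𝓝[>] 0)
      (𝓝 (EE k)) := by
  have hk' : (0 : ℝ) < k := by exact_mod_cast hk
  have hi := fam_int hk hσ h ((pp_lim k).add_const 1)
    (h.mono (fun ε h => (pp_gt h.hk h.hek).trans (by linarith)))
  have e : ∀ t : ℝ, ((1 + t ^ 2 / (((k : ℝ) + 2) * k)) ^ (-(k : ℝ) / 2)) ^ (((k : ℝ) + 4) / k + 1) =
     (1 + t ^ 2 / (((k : ℝ) + 2) * k)) ^ (-((k : ℝ) + 2)) := by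
    intro t
    rw [← Real.rpow_mul (by positivity)]
    congr 1; field_simp; ring
  simp_rw [e] at hi
  rw [E_const hk] at hi
  refine hi.congr' ?_
  filter_upwards [h] with ε h
  have hp := pp_gt1 h.hk h.hek
  have hs : Icc (σ ε) (ρ ε) ⊆ Icc (σ ε) (τ ε) := Icc_subset_Icc le_rfl h.hρτ.le
  have c0 := h.cv.mono hs
  have c1 := h.cP.mono hs
  have := intervalIntegral.integral_eq_sub_of_hasDerivAt_of_le h.hσρ.le
    (f := PP k ε (v ε) (v1 ε)) (f' := fun r => aa k ε * (r ^ (k + 1) * v ε r ^ (pp k ε + 1)))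
    c1 (fun x hx => h.dPp hx)
    (by
      apply ContinuousOn.intervalIntegrable
      rw [uIcc_of_le h.hσρ.le]
      have : ContinuousOn (fun r => v ε r ^ (pp k ε + 1)) (Icc (σ ε) (ρ ε)) :=
        c0.rpow_const (fun x _ => Or.inr (by linarith))
      fun_prop)
  rw [← this, intervalIntegral.integral_const_mul]
  field_simp [h.aa_pos.ne']

end fam


section fam2
variable {k : ℕ} {σ ρ τ : ℝ → ℝ} {v v1 : ℝ → ℝ → ℝ}

lemma M0_eq {k : ℕ} {ε σ ρ τ : ℝ} {v v1 : ℝ → ℝ} (h : Bub k ε σ ρ τ v v1) :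
    -(ρ * v1 ρ) / k = -(ρ ^ (k + 1) * v1 ρ) / k / ρ ^ k := by
  have hk := h.kpos
  have hρ := h.rpos h.hσρ
  field_simp
  ring

lemma fam_M0 (hk : 1 ≤ k) (hσ : Tendsto σ (𝓝[>] 0) (𝓝 0))
    (h : ∀ᶠ ε in 𝓝[>] (0 : ℝ), Bub k ε (σ ε) (ρ ε) (τ ε) (v ε) (v1 ε)) :
    Tendsto (fun ε => -(ρ ε * v1 ε (ρ ε)) / k) (𝓝[>] 0) (𝓝 0) := by
  have h1 := (fam_Phi hk hσ h).div_const (k : ℝ)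
  have h2 : Tendsto (fun ε => ρ ε ^ k) (𝓝[>] 0) atTop :=
    (tendsto_pow_atTop (by omega)).comp (fam_rho hk hσ h)
  refine (h1.div_atTop h2).congr' ?_
  filter_upwards [h] with ε h
  exact (M0_eq h).symm

lemma fam_eta (hk : 1 ≤ k) (hσ : Tendsto σ (𝓝[>] 0) (𝓝 0))
    (h : ∀ᶠ ε in 𝓝[>] (0 : ℝ), Bub k ε (σ ε) (ρ ε) (τ ε) (v ε) (v1 ε)) :
    Tendsto (fun ε => (-(ρ ε * v1 ε (ρ ε)) / k) ^ (pp k ε - 1) * ρ ε ^ 2) (𝓝[>] 0) (𝓝 0) := by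
  have hk' : (0 : ℝ) < k := by exact_mod_cast hk
  have h1 := (fam_Phi hk hσ h).div_const (k : ℝ)
  have hρ := fam_rho hk hσ h
  have h2 := h1.rpow ((pp_lim k).sub_const 1) (Or.inl (by positivity))
  have h3 := h2.mul (tendsto_inv_atTop_zero.comp hρ)
  rw [mul_zero] at h3
  refine tendsto_of_tendsto_of_tendsto_of_le_of_le' tendsto_const_nhds h3 ?_ ?_
  · filter_upwards [h] with ε h
    have := h.M0_pos
    positivity
  · filter_upwards [h, hρ.eventually_ge_atTop 1] with ε h hr
    have hr0 : 0 < ρ ε := by linarith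
    have hP : 0 < -(ρ ε ^ (k + 1) * v1 ε (ρ ε)) / k := div_pos h.Phi_pos hk'
    have hpp := pp_gt h.hk h.hek
    rw [M0_eq h, Real.div_rpow hP.le (by positivity), div_mul_eq_mul_div, mul_div_assoc]
    apply mul_le_mul_of_nonneg_left _ (by positivity)
    simp only [Function.comp]
    have : (ρ ε) ^ 3 ≤ (ρ ε ^ k) ^ (pp k ε - 1) := by
      rw [← Real.rpow_natCast _ k, ← Real.rpow_mul hr0.le, ← Real.rpow_natCast _ 3]
      apply Real.rpow_le_rpow_of_exponent_le hr
      have : 3 / (k : ℝ) ≤ pp k ε - 1 := by linarith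
      rw [div_le_iff₀ hk'] at this
      push_cast; linarith
    rw [div_le_iff₀ (by positivity)]
    calc ρ ε ^ 2 = (ρ ε)⁻¹ * ρ ε ^ 3 := by field_simp
      _ ≤ _ := by gcongr

lemma fam_M (hk : 1 ≤ k) (hσ : Tendsto σ (𝓝[>] 0) (𝓝 0))
    (h : ∀ᶠ ε in 𝓝[>] (0 : ℝ), Bub k ε (σ ε) (ρ ε) (τ ε) (v ε) (v1 ε)) :
    Tendsto (fun ε => (-v ε (τ ε)) / (-(ρ ε * v1 ε (ρ ε)) / k)) (𝓝[>] 0) (𝓝 1) := by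
  have hk' : (0 : ℝ) < k := by exact_mod_cast hk
  have hη := fam_eta hk hσ h
  rw [tendsto_order]
  constructor
  · intro b hb
    set K := max 1 (2 / (1 - b))
    have hb' : 0 < 1 - b := by linarith
    have hK1 : 1 ≤ K := le_max_left _ _
    have hK0 : 0 < K := by linarith
    have hKb : 1 / K ^ k < 1 - b := by
      have h1 : K ≤ K ^ k := le_self_pow₀ hK1 (by omega)
      have h2 : 2 / (1 - b) ≤ K := le_max_right _ _
      rw [div_lt_iff₀ (by positivity)]
      rw [div_le_iff₀ hb'] at h2
      nlinarith
    have l1 : Tendsto (fun ε => K ^ (k + 2) * ((-(ρ ε * v1 ε (ρ ε)) / k) ^ (pp k ε - 1) * ρ ε ^ 2))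
      (𝓝[>] 0) (𝓝 (K ^ (k + 2) * 0)) := hη.const_mul _
    have l2 : Tendsto (fun ε => 1 - 1 / K ^ k - ((-(ρ ε * v1 ε (ρ ε)) / k) ^ (pp k ε - 1) * ρ ε ^ 2) *
        K ^ 2 / (2 * (k + 2))) (𝓝[>] 0) (𝓝 (1 - 1 / K ^ k - 0 * K ^ 2 / (2 * (k + 2)))) :=
      ((hη.mul_const _).div_const _).const_sub _
    filter_upwards [h, l1.eventually_lt_const (u := ((k : ℝ) + 2) * k) (by rw [mul_zero]; positivity),
      l2.eventually_const_lt (u := b) (by simp only [zero_mul, zero_div]; linarith)] with ε h a1 a2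
    have := h.VT_low hK1 a1.le
    refine a2.trans_le ?_
    rw [le_div_iff₀ h.M0_pos]
    linarith
  · intro b hb
    filter_upwards [h] with ε h
    refine lt_of_le_of_lt ?_ hb
    rw [div_le_one h.M0_pos]
    exact h.VT ⟨h.hρτ.le, le_rfl⟩

lemma fam_P2 (hk : 1 ≤ k) (hσ : Tendsto σ (𝓝[>] 0) (𝓝 0))
    (h : ∀ᶠ ε in 𝓝[>] (0 : ℝ), Bub k ε (σ ε) (ρ ε) (τ ε) (v ε) (v1 ε)) :
    Tendsto (fun ε => (PP k ε (v ε) (v1 ε) (τ ε) - PP k ε (v ε) (v1 ε) (σ ε)) / aa k ε) (𝓝[>] 0)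
      (𝓝 (EE k)) := by
  have h1 := fam_P1 hk hσ h
  have h2 := h1.add ((fam_M0 hk hσ h).mul (fam_Phi hk hσ h))
  rw [zero_mul, add_zero] at h2
  refine tendsto_of_tendsto_of_tendsto_of_le_of_le' h1 h2 ?_ ?_
  · filter_upwards [h] with ε h
    have := h.aa_pos
    have := h.PT.1
    gcongr
  · filter_upwards [h] with ε h
    have ha := h.aa_pos
    have h3 := h.PT.2
    have h4 := h.VT (r := τ ε) ⟨h.hρτ.le, le_rfl⟩
    have h5 := h.Phi_pos
    have h6 := mul_le_mul_of_nonneg_right h4 h5.le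
    have h7 := mul_le_mul_of_nonneg_left h6 ha.le
    rw [div_add' _ _ _ ha.ne']
    gcongr
    linarith

end fam2


/-- a bubble from nonvanishing conditions only -/
lemma Bub.mk' {k : ℕ} {ε σ ρ τ : ℝ} {v v1 : ℝ → ℝ} (hk : 1 ≤ k) (he : 0 < ε) (hek : ε * k ≤ 1)
    (hσ : 0 ≤ σ) (hσρ : σ < ρ) (hρτ : ρ < τ) (cv : ContinuousOn v (Icc σ τ))
    (cv1 : ContinuousOn v1 (Icc σ τ)) (dv : ∀ r ∈ Ioo σ τ, HasDerivAt v (v1 r) r)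
    (dv1 : ∀ r ∈ Ioo σ τ,
      HasDerivAt v1 (-(((k : ℝ) + 1) / r * v1 r) - |v r| ^ (pp k ε - 1) * v r) r)
    (vσ : v σ = 1) (v1σ : v1 σ = 0) (vρ : v ρ = 0) (v1τ : v1 τ = 0)
    (vne : ∀ r ∈ Ico σ ρ, v r ≠ 0) (v1ne : ∀ r ∈ Ioo σ τ, v1 r ≠ 0) :
    Bub k ε σ ρ τ v v1 := by
  have vpos : ∀ r ∈ Ico σ ρ, 0 < v r := by
    intro x hx
    by_contra! hc
    obtain ⟨y, hy, hy0⟩ := intermediate_value_Icc' hx.1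
      (cv.mono (Icc_subset_Icc le_rfl (hx.2.trans hρτ).le)) ⟨hc, by rw [vσ]; exact zero_le_one⟩
    exact vne y ⟨hy.1, hy.2.trans_lt hx.2⟩ hy0
  have v1neg : ∀ r ∈ Ioo σ τ, v1 r < 0 := by
    obtain ⟨y, hy, hy1⟩ := exists_hasDerivAt_eq_slope v v1 hσρ
      (cv.mono (Icc_subset_Icc le_rfl hρτ.le)) (fun x hx => dv x ⟨hx.1, hx.2.trans hρτ⟩)
    have hyneg : v1 y < 0 := by
      rw [hy1, vρ, vσ]
      exact div_neg_of_neg_of_pos (by norm_num) (by linarith)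
    intro x hx
    by_contra! hc
    have hP : IsPreconnected (Ioo σ τ) := isPreconnected_Ioo
    obtain ⟨z, hz, hz0⟩ := hP.intermediate_value (f := v1) (a := y) (b := x)
      ⟨hy.1, hy.2.trans hρτ⟩ hx (cv1.mono Ioo_subset_Icc_self) ⟨hyneg.le, hc⟩
    exact v1ne z hz hz0
  have anti : StrictAntiOn v (Icc σ τ) := by
    apply strictAntiOn_of_deriv_neg (convex_Icc _ _) cv
    rw [interior_Icc]
    intro x hx
    rw [(dv x hx).deriv]
    exact v1neg x hx
  have vneg : ∀ r ∈ Ioc ρ τ, v r < 0 := by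
    intro x hx
    rw [← vρ]
    exact anti ⟨hσρ.le, hρτ.le⟩ ⟨(hσρ.trans hx.1).le, hx.2⟩ hx.1
  exact ⟨hk, he, hek, hσ, hσρ, hρτ, cv, cv1, dv, dv1, vσ, v1σ, vρ, v1τ, vpos, vneg, v1neg⟩

/-- the whole-space solution -/
structure Sol (k : ℕ) (ε : ℝ) (w w1 : ℝ → ℝ) (s r : ℕ → ℝ) : Prop where
  hk : 1 ≤ k
  he : 0 < ε
  hek : ε * k ≤ 1
  c0 : ContinuousOn w (Ici 0)
  c1 : ContinuousOn w1 (Ici 0)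
  d0 : ∀ x, 0 < x → HasDerivAt w (w1 x) x
  d1 : ∀ x, 0 < x → HasDerivAt w1 (-(((k : ℝ) + 1) / x * w1 x) - |w x| ^ (pp k ε - 1) * w x) x
  w0 : w 0 = 1
  s1 : s 1 = 0
  il : ∀ i : ℕ, 1 ≤ i → s i < r i ∧ r i < s (i + 1)
  zer : {x : ℝ | x ∈ Ioi (0 : ℝ) ∧ w x = 0} = r '' {i : ℕ | 1 ≤ i}
  cri : {x : ℝ | x ∈ Ici (0 : ℝ) ∧ w1 x = 0} = s '' {i : ℕ | 1 ≤ i}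

lemma Sol.of {n k : ℕ} (hnk : n = k + 2) (hk : 1 ≤ k) {ε : ℝ} {w : ℝ → ℝ} {s r : ℕ → ℝ}
    (he : 0 < ε) (hek : ε * k ≤ 1)
    (hc : ContDiffOn ℝ 2 w (Ici 0)) (h0 : w 0 = 1) (h00 : deriv w 0 = 0)
    (hode : ∀ x ∈ Set.Ioi (0 : ℝ),
        deriv (fun t => t ^ (n - 1) * deriv w t) x
          = -(|w x| ^ (pp k ε - 1) * w x * x ^ (n - 1)))
    (hs1 : s 1 = 0) (hil : ∀ i : ℕ, 1 ≤ i → s i < r i ∧ r i < s (i + 1))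
    (hz : {x : ℝ | x ∈ Set.Ioi (0 : ℝ) ∧ w x = 0} = r '' {i : ℕ | 1 ≤ i})
    (hcr : {x : ℝ | x ∈ Set.Ici (0 : ℝ) ∧ deriv w x = 0} = s '' {i : ℕ | 1 ≤ i}) :
    Sol k ε w (derivWithin w (Ici 0)) s r := by
  have hp := pp_gt1 hk hek
  have hud : UniqueDiffOn ℝ (Ici (0 : ℝ)) := uniqueDiffOn_Ici 0
  have hC1 : ContDiffOn ℝ 1 (derivWithin w (Ici 0)) (Ici 0) := hc.derivWithin hud (by norm_num)
  have hC0 : ContDiffOn ℝ 0 (derivWithin (derivWithin w (Ici 0)) (Ici 0)) (Ici 0) :=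
    hC1.derivWithin hud (by norm_num)
  set w1 := derivWithin w (Ici 0) with hw1
  set g := derivWithin w1 (Ici 0) with hg
  have eqd : ∀ x, 0 < x → deriv w x = w1 x := fun x hx =>
    (derivWithin_of_mem_nhds (Ici_mem_nhds hx)).symm
  have d0 : ∀ x, 0 < x → HasDerivAt w (w1 x) x := fun x hx => by
    rw [← eqd x hx]
    exact ((hc.differentiableOn (by norm_num)).differentiableAt (Ici_mem_nhds hx)).hasDerivAt
  have d1 : ∀ x, 0 < x → HasDerivAt w1 (g x) x := fun x hx => by
    have := ((hC1.differentiableOn (by norm_num)).differentiableAt (Ici_mem_nhds hx)).hasDerivAt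
    rwa [← derivWithin_of_mem_nhds (Ici_mem_nhds hx)] at this
  have hgx : ∀ x, 0 < x → g x = -(((k : ℝ) + 1) / x * w1 x) - |w x| ^ (pp k ε - 1) * w x := by
    intro x hx
    have h1 := hode x hx
    have h2 : (fun t => t ^ (n - 1) * deriv w t) =ᶠ[𝓝 x] (fun t => t ^ (n - 1) * w1 t) := by
      filter_upwards [lt_mem_nhds hx] with t ht
      rw [eqd t ht]
    have h4 : deriv (fun t => t ^ (n - 1) * w1 t) x = _ :=
      ((hasDerivAt_pow (n - 1) x).mul (d1 x hx)).deriv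
    rw [h2.deriv_eq, h4] at h1
    subst hnk
    have e1 : k + 2 - 1 = k + 1 := by omega
    rw [e1] at h1
    simp only [Nat.add_sub_cancel] at h1
    push_cast at h1
    have hxk : x ^ (k + 1) ≠ 0 := by positivity
    apply mul_left_cancel₀ hxk
    have h3 : x ^ (k + 1) * (-(((k : ℝ) + 1) / x * w1 x) - |w x| ^ (pp k ε - 1) * w x)
      = -((k : ℝ) + 1) * x ^ k * w1 x - |w x| ^ (pp k ε - 1) * w x * x ^ (k + 1) := by
      field_simp
      ring
    rw [h3]
    linarith
  have hw10 : w1 0 = 0 := by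
    have cf : ContinuousOn (fun x => |w x| ^ (pp k ε - 1)) (Ici 0) :=
      hc.continuousOn.abs.rpow_const (fun x _ => Or.inr (by linarith))
    have cg : ContinuousOn (fun x => ((k : ℝ) + 1) * w1 x + x * (g x + |w x| ^ (pp k ε - 1) * w x)) (Ici 0) := by
      have a1 := hc.continuousOn
      have a2 := hC1.continuousOn
      have a3 := hC0.continuousOn
      fun_prop
    have t1 := (cg 0 self_mem_Ici).mono_left (nhdsWithin_mono 0 Ioi_subset_Ici_self)
    have t2 : Tendsto (fun x => ((k : ℝ) + 1) * w1 x + x * (g x + |w x| ^ (pp k ε - 1) * w x)) (𝓝[>] 0) (𝓝 0) := by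
      refine tendsto_const_nhds.congr' ?_
      filter_upwards [self_mem_nhdsWithin] with x hx
      have hx : 0 < x := hx
      rw [hgx x hx]
      field_simp
      ring
    have := tendsto_nhds_unique t1 t2
    simp only [zero_mul, add_zero] at this
    rcases mul_eq_zero.1 this with h | h
    · exfalso; have : (0 : ℝ) < k + 1 := by positivity
      linarith
    · exact h
  refine ⟨hk, he, hek, hc.continuousOn, hC1.continuousOn, d0, fun x hx => hgx x hx ▸ d1 x hx, h0, hs1, hil, hz, ?_⟩
  rw [← hcr]
  ext x
  simp only [mem_ofPred_eq, mem_Ici]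
  apply and_congr_right
  intro hx
  rcases hx.eq_or_lt with rfl | hx
  · simp [h00, hw10]
  · rw [eqd x hx]

namespace Sol
variable {k : ℕ} {ε : ℝ} {w w1 : ℝ → ℝ} {s r : ℕ → ℝ}

lemma s_mono (h : Sol k ε w w1 s r) {i j : ℕ} (hi : 1 ≤ i) (hij : i ≤ j) : s i ≤ s j := by
  induction j, hij using Nat.le_induction with
  | base => exact le_rfl
  | succ j hj ih =>
    have := h.il j (hi.trans hj)
    linarith

lemma s_nonneg (h : Sol k ε w w1 s r) {i : ℕ} (hi : 1 ≤ i) : 0 ≤ s i := by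
  rw [← h.s1]; exact h.s_mono le_rfl hi

lemma r_pos (h : Sol k ε w w1 s r) {i : ℕ} (hi : 1 ≤ i) : 0 < r i :=
  (h.s_nonneg hi).trans_lt (h.il i hi).1

lemma w1_ne (h : Sol k ε w w1 s r) {i : ℕ} (hi : 1 ≤ i) {x : ℝ} (hx : x ∈ Ioo (s i) (s (i + 1))) :
    w1 x ≠ 0 := by
  intro h0
  have : x ∈ {x : ℝ | x ∈ Ici (0 : ℝ) ∧ w1 x = 0} := ⟨(h.s_nonneg hi).trans hx.1.le, h0⟩
  rw [h.cri] at this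
  obtain ⟨j, hj, rfl⟩ := this
  rcases Nat.lt_or_ge i j with hij | hij
  · have := h.s_mono (show 1 ≤ i + 1 by omega) (show i + 1 ≤ j from hij)
    linarith [hx.2]
  · have := h.s_mono hj hij
    linarith [hx.1]

lemma w_ne (h : Sol k ε w w1 s r) {i : ℕ} (hi : 1 ≤ i) {x : ℝ} (hx : x ∈ Ico (s i) (r i)) :
    w x ≠ 0 := by
  intro h0
  have hx0 := (h.s_nonneg hi).trans hx.1
  rcases hx0.eq_or_lt with rfl | hx0
  · rw [h.w0] at h0; exact one_ne_zero h0
  have : x ∈ {x : ℝ | x ∈ Ioi (0 : ℝ) ∧ w x = 0} := ⟨hx0, h0⟩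
  rw [h.zer] at this
  obtain ⟨j, hj, rfl⟩ := this
  have hj : 1 ≤ j := hj
  rcases Nat.lt_or_ge j i with hij | hij
  · have := h.s_mono (show 1 ≤ j + 1 by omega) (show j + 1 ≤ i from hij)
    have := h.il j hj
    linarith [hx.1]
  · have h1 := h.s_mono hi hij
    rcases hij.eq_or_lt with rfl | hij
    · exact lt_irrefl _ hx.2
    · have h1 := h.s_mono (show 1 ≤ i + 1 by omega) (show i + 1 ≤ j from hij)
      have := h.il j hj
      have := h.il i hi
      linarith [hx.2]

lemma s_crit (h : Sol k ε w w1 s r) {i : ℕ} (hi : 1 ≤ i) : w1 (s i) = 0 := by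
  have : s i ∈ s '' {i : ℕ | 1 ≤ i} := ⟨i, hi, rfl⟩
  rw [← h.cri] at this
  exact this.2

lemma r_zero (h : Sol k ε w w1 s r) {i : ℕ} (hi : 1 ≤ i) : w (r i) = 0 := by
  have : r i ∈ r '' {i : ℕ | 1 ≤ i} := ⟨i, hi, rfl⟩
  rw [← h.zer] at this
  exact this.2

lemma mu_pos (h : Sol k ε w w1 s r) {i : ℕ} (hi : 1 ≤ i) : 0 < |w (s i)| :=
  abs_pos.2 (h.w_ne hi ⟨le_rfl, (h.il i hi).1⟩)

end Sol

/-- scaling factor -/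
def lam (k : ℕ) (ε μ : ℝ) : ℝ := μ ^ ((pp k ε - 1) / 2)

lemma lam_pos {k : ℕ} {ε μ : ℝ} (hμ : 0 < μ) : 0 < lam k ε μ := Real.rpow_pos_of_pos hμ _

lemma lam_sq {k : ℕ} {ε μ : ℝ} (hμ : 0 < μ) : lam k ε μ ^ 2 = μ ^ (pp k ε - 1) := by
  unfold lam
  rw [← Real.rpow_natCast, ← Real.rpow_mul hμ.le]
  congr 1; push_cast; ring

lemma lam_k {k : ℕ} (hk : 1 ≤ k) {ε μ : ℝ} (hμ : 0 < μ) :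
    lam k ε μ ^ k * μ ^ (ε * k / 2) = μ ^ 2 := by
  have hk' : (0 : ℝ) < k := by exact_mod_cast hk
  unfold lam
  rw [← Real.rpow_natCast, ← Real.rpow_mul hμ.le, ← Real.rpow_add hμ, ← Real.rpow_natCast μ 2]
  congr 1; unfold pp; push_cast; field_simp; ring

lemma Sol.bub {k : ℕ} {ε : ℝ} {w w1 : ℝ → ℝ} {s r : ℕ → ℝ} (h : Sol k ε w w1 s r) {i : ℕ}
    (hi : 1 ≤ i) :
    Bub k ε (s i * lam k ε |w (s i)|) (r i * lam k ε |w (s i)|) (s (i + 1) * lam k ε |w (s i)|)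
      (fun x => w (x / lam k ε |w (s i)|) / w (s i))
      (fun x => w1 (x / lam k ε |w (s i)|) / (lam k ε |w (s i)| * w (s i))) := by
  have hμ := h.mu_pos hi
  have hL2 := lam_sq (k := k) (ε := ε) hμ
  have hL := lam_pos (k := k) (ε := ε) hμ
  set L := lam k ε |w (s i)|
  have hA : w (s i) ≠ 0 := abs_pos.1 hμ
  have hs0 := h.s_nonneg hi
  have hil := h.il i hi
  have hsub : MapsTo (fun x => x / L) (Icc (s i * L) (s (i + 1) * L)) (Ici 0) := by
    intro x hx
    have : s i ≤ x / L := by rw [le_div_iff₀ hL]; exact hx.1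
    exact hs0.trans this
  have hmem : ∀ x ∈ Ioo (s i * L) (s (i + 1) * L), x / L ∈ Ioo (s i) (s (i + 1)) := by
    intro x hx
    exact ⟨by rw [lt_div_iff₀ hL]; exact hx.1, by rw [div_lt_iff₀ hL]; exact hx.2⟩
  apply Bub.mk' h.hk h.he h.hek
  · positivity
  · exact mul_lt_mul_of_pos_right hil.1 hL
  · exact mul_lt_mul_of_pos_right hil.2 hL
  · exact (h.c0.comp (by fun_prop) hsub).div_const _
  · exact (h.c1.comp (by fun_prop) hsub).div_const _
  · intro x hx
    have hx' := hmem x hx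
    have := (HasDerivAt.comp x (h.d0 (x / L) (hs0.trans_lt hx'.1)) ((hasDerivAt_id x).div_const L)).div_const (w (s i))
    refine this.congr_deriv ?_
    field_simp
  · intro x hx
    have hx' := hmem x hx
    have hx0 : 0 < x / L := hs0.trans_lt hx'.1
    have hxp : 0 < x := by
      have := mul_pos hx0 hL
      rwa [div_mul_cancel₀ _ hL.ne'] at this
    have := (HasDerivAt.comp x (h.d1 (x / L) hx0) ((hasDerivAt_id x).div_const L)).div_const (L * w (s i))
    refine this.congr_deriv ?_
    rw [abs_div, Real.div_rpow (abs_nonneg _) (abs_nonneg _), ← hL2]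
    field_simp
  · simp [hL.ne', hA]
  · simp [hL.ne', h.s_crit hi]
  · simp [hL.ne', h.r_zero hi]
  · simp [hL.ne', h.s_crit (show 1 ≤ i + 1 by omega)]
  · intro x hx
    apply div_ne_zero _ hA
    apply h.w_ne hi
    exact ⟨by rw [le_div_iff₀ hL]; exact hx.1, by rw [div_lt_iff₀ hL]; exact hx.2⟩
  · intro x hx
    apply div_ne_zero _ (mul_ne_zero hL.ne' hA)
    exact h.w1_ne hi (hmem x hx)


namespace Sol
variable {k : ℕ} {ε : ℝ} {w w1 : ℝ → ℝ} {s r : ℕ → ℝ}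

/-- theta -/
def th (k : ℕ) (ε μ : ℝ) : ℝ := μ ^ (ε * k / 2)

lemma th_pos {k : ℕ} {ε μ : ℝ} (hμ : 0 < μ) : 0 < th k ε μ := Real.rpow_pos_of_pos hμ _

lemma sgn (h : Sol k ε w w1 s r) {i : ℕ} (hi : 1 ≤ i) :
    w1 (r i) / w (s i) = -(|w1 (r i)| / |w (s i)|) := by
  have hb := (h.bub hi)
  have h1 := hb.v1neg _ ⟨hb.hσρ, hb.hρτ⟩
  have hμ := h.mu_pos hi
  have hL := lam_pos (k := k) (ε := ε) hμ
  simp only [mul_div_cancel_right₀ _ hL.ne'] at h1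
  rw [← abs_div, abs_of_neg]
  · ring
  · have : w1 (r i) / w (s i) = w1 (r i) / (lam k ε |w (s i)| * w (s i)) * lam k ε |w (s i)| := by
      have := abs_pos.1 hμ
      field_simp
    rw [this]
    exact mul_neg_of_neg_of_pos h1 hL

lemma sgn2 (h : Sol k ε w w1 s r) {i : ℕ} (hi : 1 ≤ i) :
    w (s (i + 1)) / w (s i) = -(|w (s (i + 1))| / |w (s i)|) := by
  have hb := (h.bub hi)
  have h1 := hb.vneg _ ⟨hb.hρτ, le_rfl⟩
  have hμ := h.mu_pos hi
  have hL := lam_pos (k := k) (ε := ε) hμ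
  simp only [mul_div_cancel_right₀ _ hL.ne'] at h1
  rw [← abs_div, abs_of_neg h1]
  ring

lemma id_Phi (h : Sol k ε w w1 s r) {i : ℕ} (hi : 1 ≤ i) :
    -((r i * lam k ε |w (s i)|) ^ (k + 1) *
      (w1 (r i * lam k ε |w (s i)| / lam k ε |w (s i)|) / (lam k ε |w (s i)| * w (s i)))) =
    r i ^ (k + 1) * |w1 (r i)| * |w (s i)| / th k ε |w (s i)| := by
  have hμ := h.mu_pos hi
  have hL := lam_pos (k := k) (ε := ε) hμ
  have hk := lam_k h.hk (ε := ε) hμ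
  have hs := h.sgn hi
  have ht := th_pos (k := k) (ε := ε) hμ
  change _ * th k ε |w (s i)| = _ at hk
  rw [mul_div_cancel_right₀ _ hL.ne', mul_comm (lam _ _ _), ← div_div, hs]
  generalize |w (s i)| = μ at *
  generalize lam k ε μ = L at *
  generalize th k ε μ = t at *
  rw [eq_div_iff ht.ne', mul_pow, pow_succ L]
  field_simp
  linear_combination r i ^ (k + 1) * |w1 (r i)| * hk

lemma id_A (h : Sol k ε w w1 s r) {i : ℕ} (hi : 1 ≤ i) :
    (r i * lam k ε |w (s i)|) ^ (k + 2) *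
      (w1 (r i * lam k ε |w (s i)| / lam k ε |w (s i)|) / (lam k ε |w (s i)| * w (s i))) ^ 2 =
    r i ^ (k + 2) * |w1 (r i)| ^ 2 / th k ε |w (s i)| := by
  have hμ := h.mu_pos hi
  have hL := lam_pos (k := k) (ε := ε) hμ
  have hk := lam_k h.hk (ε := ε) hμ
  have hs := h.sgn hi
  have ht := th_pos (k := k) (ε := ε) hμ
  change _ * th k ε |w (s i)| = _ at hk
  rw [mul_div_cancel_right₀ _ hL.ne', mul_comm (lam _ _ _), ← div_div, hs]
  generalize |w (s i)| = μ at *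
  generalize lam k ε μ = L at *
  generalize th k ε μ = t at *
  rw [eq_div_iff ht.ne', mul_pow, pow_add L]
  field_simp
  linear_combination r i ^ (k + 2) * |w1 (r i)| ^ 2 * hk

lemma id_M0 (h : Sol k ε w w1 s r) {i : ℕ} (hi : 1 ≤ i) :
    -((r i * lam k ε |w (s i)|) *
      (w1 (r i * lam k ε |w (s i)| / lam k ε |w (s i)|) / (lam k ε |w (s i)| * w (s i)))) / k =
    r i * |w1 (r i)| / |w (s i)| / k := by
  have hμ := h.mu_pos hi
  have hL := lam_pos (k := k) (ε := ε) hμ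
  have hs := h.sgn hi
  rw [mul_div_cancel_right₀ _ hL.ne', mul_comm (lam _ _ _), ← div_div, hs]
  field_simp

lemma lam_k2 {k : ℕ} (hk : 1 ≤ k) {ε μ : ℝ} (hμ : 0 < μ) :
    lam k ε μ ^ (k + 2) = μ ^ (pp k ε + 1) / th k ε μ := by
  have h1 := lam_k hk (ε := ε) hμ
  have h2 := lam_sq (k := k) (ε := ε) hμ
  have ht := th_pos (k := k) (ε := ε) hμ
  change _ * th k ε μ = _ at h1
  have h3 : μ ^ (pp k ε + 1) = μ ^ (pp k ε - 1) * μ ^ 2 := by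
    rw [← Real.rpow_natCast μ 2, ← Real.rpow_add hμ]
    congr 1; push_cast; ring
  rw [eq_div_iff ht.ne', h3, ← h1, ← h2]; ring

lemma id_tau (h : Sol k ε w w1 s r) {i : ℕ} (hi : 1 ≤ i) :
    (s (i + 1) * lam k ε |w (s i)|) ^ (k + 2) *
      (-(w (s (i + 1) * lam k ε |w (s i)| / lam k ε |w (s i)|) / w (s i))) ^ (pp k ε + 1) =
    s (i + 1) ^ (k + 2) * |w (s (i + 1))| ^ (pp k ε + 1) / th k ε |w (s i)| := by
  have hμ := h.mu_pos hi
  have hL := lam_pos (k := k) (ε := ε) hμ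
  have hs := h.sgn2 hi
  have ht := th_pos (k := k) (ε := ε) hμ
  rw [mul_div_cancel_right₀ _ hL.ne', hs, neg_neg, Real.div_rpow (abs_nonneg _) (abs_nonneg _),
    mul_pow, lam_k2 h.hk hμ]
  have : |w (s i)| ^ (pp k ε + 1) ≠ 0 := (Real.rpow_pos_of_pos hμ _).ne'
  field_simp

lemma id_sigma (h : Sol k ε w w1 s r) {i : ℕ} (hi : 1 ≤ i) :
    (s i * lam k ε |w (s i)|) ^ (k + 2) =
    s i ^ (k + 2) * |w (s i)| ^ (pp k ε + 1) / th k ε |w (s i)| := by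
  rw [mul_pow, lam_k2 h.hk (h.mu_pos hi)]; ring

lemma id_M (h : Sol k ε w w1 s r) {i : ℕ} (hi : 1 ≤ i) :
      (-(w (s (i + 1) * lam k ε |w (s i)| / lam k ε |w (s i)|) / w (s i))) =
    |w (s (i + 1))| / |w (s i)| := by
  have hμ := h.mu_pos hi
  have hL := lam_pos (k := k) (ε := ε) hμ
  rw [mul_div_cancel_right₀ _ hL.ne', h.sgn2 hi, neg_neg]

end Sol


/-- kappa in terms of k -/
def kap (k : ℕ) : ℝ :=
  ((k : ℝ) / 4) * Real.Gamma (((k : ℝ) + 2) / 2) ^ 2 / Real.Gamma ((k : ℝ) + 2)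

/-- the constant `c ^ (n/2)` -/
def CC (k : ℕ) : ℝ := (((k : ℝ) + 2) * k) ^ (((k : ℝ) + 2) / 2)

lemma kap_pos {k : ℕ} (hk : 1 ≤ k) : 0 < kap k := by
  have hk' : (0 : ℝ) < k := by exact_mod_cast hk
  have h1 : 0 < Real.Gamma (((k : ℝ) + 2) / 2) := Real.Gamma_pos_of_pos (by positivity)
  have h2 : 0 < Real.Gamma ((k : ℝ) + 2) := Real.Gamma_pos_of_pos (by positivity)
  unfold kap; positivity

lemma CC_pos {k : ℕ} (hk : 1 ≤ k) : 0 < CC k := by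
  have hk' : (0 : ℝ) < k := by exact_mod_cast hk
  unfold CC; positivity

lemma EE_eq {k : ℕ} (hk : 1 ≤ k) : EE k = CC k * (2 * kap k / k) := by
  have hk' : (0 : ℝ) < k := by exact_mod_cast hk
  have h2 : 0 < Real.Gamma ((k : ℝ) + 2) := Real.Gamma_pos_of_pos (by positivity)
  unfold EE CC kap
  field_simp
  ring

lemma fam_pos : ∀ᶠ ε in 𝓝[>] (0 : ℝ), 0 < ε := by
  filter_upwards [self_mem_nhdsWithin] with ε h using h

section fam3
variable {k : ℕ} {W W1 : ℝ → ℝ → ℝ} {S R : ℝ → ℕ → ℝ}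

lemma X_lim (k : ℕ) : Tendsto (fun ε : ℝ => kap k * ε) (𝓝[>] 0) (𝓝 0) := by
  have := fam_id.const_mul (kap k)
  rwa [mul_zero] at this

lemma aa_lim {k : ℕ} (hk : 1 ≤ k) :
    Tendsto (fun ε => aa k ε / (kap k * ε)) (𝓝[>] 0) (𝓝 (k ^ 2 / (4 * (k + 2) * kap k))) := by
  have hk' : (0 : ℝ) < k := by exact_mod_cast hk
  have hκ := kap_pos hk
  have h1 : Tendsto (fun ε => (k : ℝ) / (2 * (pp k ε + 1) * kap k)) (𝓝[>] 0)
    (𝓝 ((k : ℝ) / (2 * (((k : ℝ) + 4) / k + 1) * kap k))) := by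
    apply tendsto_const_nhds.div
    · exact (((pp_lim k).add_const 1).const_mul 2).mul_const _
    · positivity
  have e : (k : ℝ) / (2 * (((k : ℝ) + 4) / k + 1) * kap k) = k ^ 2 / (4 * (k + 2) * kap k) := by
    field_simp; ring
  rw [e] at h1
  refine h1.congr' ?_
  filter_upwards [fam_pos] with ε he
  unfold aa
  field_simp

lemma step (H : ∀ᶠ ε in 𝓝[>] (0 : ℝ), Sol k ε (W ε) (W1 ε) (S ε) (R ε)) (hk : 1 ≤ k)
    {i : ℕ} (hi : 1 ≤ i) {q : ℝ}
    (hQ : Tendsto (fun ε => S ε i ^ (k + 2) * |W ε (S ε i)| ^ (pp k ε + 1) / (kap k * ε))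
      (𝓝[>] 0) (𝓝 q))
    (hθ : Tendsto (fun ε => Sol.th k ε |W ε (S ε i)|) (𝓝[>] 0) (𝓝 1)) :
    Tendsto (fun ε => R ε i ^ (k + 2) * |W1 ε (R ε i)| ^ 2 / (kap k * ε))
      (𝓝[>] 0) (𝓝 ((CC k + q) * (k / (k + 2)))) ∧
    Tendsto (fun ε => R ε i ^ (k + 1) * |W1 ε (R ε i)| * |W ε (S ε i)|)
      (𝓝[>] 0) (𝓝 (CC k / (k + 2))) ∧
    Tendsto (fun ε => |W ε (S ε (i + 1))| / (R ε i * |W1 ε (R ε i)|)) (𝓝[>] 0) (𝓝 (1 / k)) ∧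
    Tendsto (fun ε => S ε (i + 1) ^ (k + 2) * |W ε (S ε (i + 1))| ^ (pp k ε + 1) / (kap k * ε))
      (𝓝[>] 0) (𝓝 (CC k + q)) := by
  have hk' : (0 : ℝ) < k := by exact_mod_cast hk
  have hκ := kap_pos hk
  have hC := CC_pos hk
  have HB : ∀ᶠ ε in 𝓝[>] (0 : ℝ), _ := H.mono (fun ε h => h.bub hi)
  have hσ : Tendsto (fun ε => S ε i * lam k ε |W ε (S ε i)|) (𝓝[>] 0) (𝓝 0) := by
    have h1 := (hQ.mul (X_lim k)).div hθ one_ne_zero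
    have h2 := h1.rpow_const (p := 1 / ((k : ℝ) + 2)) (Or.inr (by positivity))
    rw [mul_zero, zero_div, Real.zero_rpow (by positivity)] at h2
    refine h2.congr' ?_
    filter_upwards [H, fam_pos] with ε h he
    have hμ := h.mu_pos hi
    have hL := lam_pos (k := k) (ε := ε) hμ
    have hs := h.s_nonneg hi
    have hx : kap k * ε ≠ 0 := by positivity
    simp only [Pi.div_apply, div_mul_cancel₀ _ hx]
    rw [← h.id_sigma hi, ← Real.rpow_natCast, ← Real.rpow_mul (by positivity)]
    push_cast
    rw [mul_one_div_cancel (by positivity), Real.rpow_one]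
  have fP := fam_Phi hk hσ HB
  have fM := fam_M hk hσ HB
  have f1 := fam_P1 hk hσ HB
  have f2 := fam_P2 hk hσ HB
  have lp := (pp_lim k).add_const 1
  have hne : (((k : ℝ) + 4) / k + 1) ≠ 0 := by positivity
  have ee : EE k * (k ^ 2 / (4 * (k + 2) * kap k)) = CC k * (k / (2 * (k + 2))) := by
    rw [EE_eq hk]; field_simp; ring
  refine ⟨?_, ?_, ?_, ?_⟩
  · have l := ((((f1.mul (aa_lim hk)).mul hθ).add (hQ.div lp hne))).const_mul 2
    have e : 2 * (EE k * (k ^ 2 / (4 * (k + 2) * kap k)) * 1 + q / (((k : ℝ) + 4) / k + 1)) =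
      (CC k + q) * (k / (k + 2)) := by rw [ee]; field_simp; ring
    rw [e] at l
    refine l.congr' ?_
    filter_upwards [H, HB, fam_pos] with ε h hb he
    have hx : kap k * ε ≠ 0 := by positivity
    have ha := hb.aa_pos
    have ht := Sol.th_pos (k := k) (ε := ε) (h.mu_pos hi)
    have hp := pp_gt1 h.hk h.hek
    have hp' : pp k ε + 1 ≠ 0 := by linarith
    simp only [Pi.div_apply]
    rw [hb.Pρ, hb.Pσ, h.id_A hi, h.id_sigma hi]
    field_simp
    ring
  · have l := fP.mul hθ
    rw [mul_one] at l
    refine l.congr' ?_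
    filter_upwards [H] with ε h
    have ht := Sol.th_pos (k := k) (ε := ε) (h.mu_pos hi)
    rw [h.id_Phi hi]
    field_simp
  · have l := fM.div_const (k : ℝ)
    refine l.congr' ?_
    filter_upwards [H] with ε h
    have hμ := h.mu_pos hi
    rw [h.id_M0 hi, h.id_M hi]
    field_simp
  · have l := ((((f2.mul (aa_lim hk)).mul hθ).mul lp).add hQ)
    have e : EE k * (k ^ 2 / (4 * (k + 2) * kap k)) * 1 * (((k : ℝ) + 4) / k + 1) + q =
      (CC k + q) := by rw [ee]; field_simp; ring
    rw [e] at l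
    refine l.congr' ?_
    filter_upwards [H, HB, fam_pos] with ε h hb he
    have hx : kap k * ε ≠ 0 := by positivity
    have ha := hb.aa_pos
    have ht := Sol.th_pos (k := k) (ε := ε) (h.mu_pos hi)
    have hp := pp_gt1 h.hk h.hek
    have hp' : pp k ε + 1 ≠ 0 := by linarith
    rw [hb.Pτ, hb.Pσ, h.id_tau hi, h.id_sigma hi]
    field_simp
    ring

lemma w1r_ne {ε : ℝ} {w w1 : ℝ → ℝ} {s r : ℕ → ℝ} (h : Sol k ε w w1 s r) {i : ℕ} (hi : 1 ≤ i) :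
    0 < |w1 (r i)| := abs_pos.2 (h.w1_ne hi (h.il i hi))

lemma step2 (H : ∀ᶠ ε in 𝓝[>] (0 : ℝ), Sol k ε (W ε) (W1 ε) (S ε) (R ε)) (hk : 1 ≤ k)
    {i : ℕ} (hi : 1 ≤ i) 
    (hQ : Tendsto (fun ε => S ε i ^ (k + 2) * |W ε (S ε i)| ^ (pp k ε + 1) / (kap k * ε))
      (𝓝[>] 0) (𝓝 (((i : ℝ) - 1) * CC k)))
    (hθ : Tendsto (fun ε => Sol.th k ε |W ε (S ε i)|) (𝓝[>] 0) (𝓝 1)) :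
    Tendsto (fun ε => R ε i ^ k * |W ε (S ε i)| ^ 2 * (kap k * ε))
      (𝓝[>] 0) (𝓝 (CC k / (((k : ℝ) + 2) * k * i))) ∧
    Tendsto (fun ε => R ε i * |W1 ε (R ε i)| / (|W ε (S ε i)| * (kap k * ε)))
      (𝓝[>] 0) (𝓝 (k * i)) ∧
    Tendsto (fun ε => |W ε (S ε (i + 1))| / (|W ε (S ε i)| * (kap k * ε))) (𝓝[>] 0) (𝓝 i) ∧
    Tendsto (fun ε => S ε (i + 1) ^ (k + 2) * |W ε (S ε (i + 1))| ^ (pp k ε + 1) / (kap k * ε))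
      (𝓝[>] 0) (𝓝 (i * CC k)) := by
  have hk' : (0 : ℝ) < k := by exact_mod_cast hk
  have hi' : (0 : ℝ) < i := by exact_mod_cast hi
  have hκ := kap_pos hk
  have hC := CC_pos hk
  obtain ⟨hA, hB, hM, hD⟩ := step H hk hi hQ hθ
  have e : CC k + ((i : ℝ) - 1) * CC k = i * CC k := by ring
  rw [e] at hA hD
  have hq : Tendsto (fun ε => R ε i * |W1 ε (R ε i)| / (|W ε (S ε i)| * (kap k * ε)))
      (𝓝[>] 0) (𝓝 (k * i)) := by
    have l := hA.div hB (by positivity)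
    have e : i * CC k * (k / (k + 2)) / (CC k / ((k : ℝ) + 2)) = k * i := by field_simp
    rw [e] at l
    refine l.congr' ?_
    filter_upwards [H, fam_pos] with ε h he
    have hμ := h.mu_pos hi
    have hr := h.r_pos hi
    have hw := w1r_ne h hi
    simp only [Pi.div_apply]
    field_simp
    try ring
  refine ⟨?_, hq, ?_, hD⟩
  · have l := (hB.pow 2).div hA (by positivity)
    have e : (CC k / ((k : ℝ) + 2)) ^ 2 / (i * CC k * (k / (k + 2))) = CC k / (((k : ℝ) + 2) * k * i) := by
      field_simp
    rw [e] at l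
    refine l.congr' ?_
    filter_upwards [H, fam_pos] with ε h he
    have hμ := h.mu_pos hi
    have hr := h.r_pos hi
    have hw := w1r_ne h hi
    simp only [Pi.div_apply]
    field_simp
    try ring
  · have l := hM.mul hq
    have e : 1 / (k : ℝ) * (k * i) = i := by field_simp
    rw [e] at l
    refine l.congr' ?_
    filter_upwards [H, fam_pos] with ε h he
    have hμ := h.mu_pos hi
    have hr := h.r_pos hi
    have hw := w1r_ne h hi
    field_simp

lemma mu_eps (hk : 1 ≤ k) {μ : ℝ → ℝ} {j : ℕ} {G : ℝ} (hG : 0 < G) (c : ℝ)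
    (hμ : ∀ᶠ ε in 𝓝[>] (0 : ℝ), 0 < μ ε)
    (h : Tendsto (fun ε => μ ε / (kap k * ε) ^ j) (𝓝[>] 0) (𝓝 G)) :
    Tendsto (fun ε => μ ε ^ (c * ε)) (𝓝[>] 0) (𝓝 1) := by
  have hκ := kap_pos hk
  have h1 := fam_id.mul (h.log hG.ne')
  have h2 : Tendsto (fun ε : ℝ => (kap k * ε) * Real.log (kap k * ε)) (𝓝[>] 0) (𝓝 (0 * Real.log 0)) :=
    (Real.continuous_mul_log.tendsto 0).comp (X_lim k)
  have h3 := ((h1.add (h2.const_mul (j / kap k))).const_mul c).rexp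
  simp only [zero_mul, mul_zero, add_zero, Real.exp_zero] at h3
  refine h3.congr' ?_
  filter_upwards [hμ, fam_pos] with ε hm he
  have hx : 0 < kap k * ε := by positivity
  rw [Real.rpow_def_of_pos hm, Real.log_div hm.ne' (by positivity), Real.log_pow]
  congr 1
  field_simp
  ring

lemma induct (H : ∀ᶠ ε in 𝓝[>] (0 : ℝ), Sol k ε (W ε) (W1 ε) (S ε) (R ε)) (hk : 1 ≤ k) (j : ℕ) :
    Tendsto (fun ε => |W ε (S ε (j + 1))| / (kap k * ε) ^ j) (𝓝[>] 0) (𝓝 (Real.Gamma (j + 1))) ∧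
    Tendsto (fun ε => S ε (j + 1) ^ (k + 2) * |W ε (S ε (j + 1))| ^ (pp k ε + 1) / (kap k * ε))
      (𝓝[>] 0) (𝓝 (j * CC k)) := by
  have hκ := kap_pos hk
  induction j with
  | zero =>
    constructor
    · have : Real.Gamma ((0 : ℕ) + 1) = 1 := by simp
      rw [this]
      refine tendsto_const_nhds.congr' ?_
      filter_upwards [H] with ε h
      simp [h.s1, h.w0]
    · simp only [Nat.cast_zero, zero_mul, zero_add]
      refine tendsto_const_nhds.congr' ?_
      filter_upwards [H] with ε h
      simp [h.s1]
  | succ j ih =>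
    obtain ⟨h1, h2⟩ := ih
    have hG : 0 < Real.Gamma ((j : ℝ) + 1) := Real.Gamma_pos_of_pos (by positivity)
    have hθ := mu_eps hk hG ((k : ℝ) / 2) (H.mono (fun ε h => h.mu_pos (show 1 ≤ j + 1 by omega))) h1
    obtain ⟨-, -, h3, h4⟩ := step2 H hk (i := j + 1) (by omega)
      (by push_cast; rw [add_sub_cancel_right]; exact h2)
      (hθ.congr (fun ε => by unfold Sol.th; congr 1; ring))
    refine ⟨?_, h4⟩
    have l := h3.mul h1
    push_cast at l ⊢
    rw [Real.Gamma_add_one (by positivity : ((j : ℝ) + 1) ≠ 0)]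
    refine l.congr' ?_
    filter_upwards [H, fam_pos] with ε h he
    have hμ := h.mu_pos (show 1 ≤ j + 1 by omega)
    field_simp
    ring

end fam3


section fin
variable {k : ℕ} {W W1 : ℝ → ℝ → ℝ} {S R : ℝ → ℕ → ℝ}

lemma fin_iv (H : ∀ᶠ ε in 𝓝[>] (0 : ℝ), Sol k ε (W ε) (W1 ε) (S ε) (R ε)) (hk : 1 ≤ k) (j : ℕ) :
    Tendsto (fun ε => |W ε (S ε (j + 1))| * (kap k * ε) ^ (-(j : ℝ))) (𝓝[>] 0)
      (𝓝 (Real.Gamma (j + 1))) := by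
  have hκ := kap_pos hk
  refine (induct H hk j).1.congr' ?_
  filter_upwards [fam_pos] with ε he
  rw [Real.rpow_neg (by positivity), Real.rpow_natCast]; rfl

lemma fin_pre (H : ∀ᶠ ε in 𝓝[>] (0 : ℝ), Sol k ε (W ε) (W1 ε) (S ε) (R ε)) (hk : 1 ≤ k) (j : ℕ) :
    Tendsto (fun ε => R ε (j + 1) ^ k * |W ε (S ε (j + 1))| ^ 2 * (kap k * ε))
      (𝓝[>] 0) (𝓝 (CC k / (((k : ℝ) + 2) * k * ((j : ℝ) + 1)))) ∧
    Tendsto (fun ε => R ε (j + 1) * |W1 ε (R ε (j + 1))| / (|W ε (S ε (j + 1))| * (kap k * ε)))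
      (𝓝[>] 0) (𝓝 (k * ((j : ℝ) + 1))) := by
  obtain ⟨h1, h2⟩ := induct H hk j
  have hG : 0 < Real.Gamma ((j : ℝ) + 1) := Real.Gamma_pos_of_pos (by positivity)
  have hθ := mu_eps hk hG ((k : ℝ) / 2) (H.mono (fun ε h => h.mu_pos (show 1 ≤ j + 1 by omega))) h1
  obtain ⟨h3, h4, -, -⟩ := step2 H hk (i := j + 1) (by omega)
      (by push_cast; rw [add_sub_cancel_right]; exact h2)
      (hθ.congr (fun ε => by unfold Sol.th; congr 1; ring))
  push_cast at h3 h4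
  exact ⟨h3, h4⟩

lemma fin_i (H : ∀ᶠ ε in 𝓝[>] (0 : ℝ), Sol k ε (W ε) (W1 ε) (S ε) (R ε)) (hk : 1 ≤ k) (j : ℕ) :
    Tendsto (fun ε => R ε (j + 1) * (kap k * ε) ^ ((2 * ((j : ℝ) + 1) - 1) / k)) (𝓝[>] 0)
      (𝓝 ((((k : ℝ) + 2) * k) ^ ((1 : ℝ) / 2) * ((j : ℝ) + 1) ^ (-(1 / (k : ℝ))) *
        Real.Gamma (j + 1) ^ (-(2 : ℝ) / k))) := by
  have hκ := kap_pos hk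
  have hC := CC_pos hk
  have hk' : (0 : ℝ) < k := by exact_mod_cast hk
  have hG : 0 < Real.Gamma ((j : ℝ) + 1) := Real.Gamma_pos_of_pos (by positivity)
  have h1 := (induct H hk j).1
  have h2 := (fin_pre H hk j).1
  have l := (h2.div (h1.pow 2) (by positivity)).rpow_const (p := 1 / (k : ℝ)) (Or.inr (by positivity))
  have e : (CC k / (((k : ℝ) + 2) * k * ((j : ℝ) + 1)) / Real.Gamma (j + 1) ^ 2) ^ (1 / (k : ℝ)) =
    ((((k : ℝ) + 2) * k) ^ ((1 : ℝ) / 2) * ((j : ℝ) + 1) ^ (-(1 / (k : ℝ))) *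
        Real.Gamma (j + 1) ^ (-(2 : ℝ) / k)) := by
    have a1 : CC k = (((k : ℝ) + 2) * k) ^ ((k : ℝ) / 2) * (((k : ℝ) + 2) * k) := by
      unfold CC
      rw [← Real.rpow_add_one (by positivity)]
      congr 1; ring
    have a2 : CC k / (((k : ℝ) + 2) * k * ((j : ℝ) + 1)) / Real.Gamma (j + 1) ^ 2 =
      (((k : ℝ) + 2) * k) ^ ((k : ℝ) / 2) * ((j : ℝ) + 1)⁻¹ * (Real.Gamma (j + 1) ^ (-2 : ℝ)) := by
      rw [a1, Real.rpow_neg hG.le, Real.rpow_ofNat]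
      field_simp
    rw [a2, Real.mul_rpow (by positivity) (by positivity), Real.mul_rpow (by positivity) (by positivity),
      ← Real.rpow_mul (by positivity), ← Real.rpow_mul hG.le, Real.inv_rpow (by positivity),
      Real.rpow_neg (by positivity)]
    congr 2
    · congr 1; field_simp
    · ring
  rw [e] at l
  refine l.congr' ?_
  filter_upwards [H, fam_pos] with ε h he
  have hx : 0 < kap k * ε := by positivity
  have hμ := h.mu_pos (show 1 ≤ j + 1 by omega)
  have hr := h.r_pos (show 1 ≤ j + 1 by omega)
  simp only [Pi.div_apply]
  have b : R ε (j + 1) ^ k * |W ε (S ε (j + 1))| ^ 2 * (kap k * ε) / (|W ε (S ε (j + 1))| / (kap k * ε) ^ j) ^ 2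
     = R ε (j + 1) ^ k * (kap k * ε) ^ (2 * ((j : ℝ) + 1) - 1) := by
    have : (kap k * ε) ^ (2 * ((j : ℝ) + 1) - 1) = (kap k * ε) * ((kap k * ε) ^ j) ^ 2 := by
      rw [← pow_mul, ← pow_succ', ← Real.rpow_natCast]
      congr 1; push_cast; ring
    rw [this]
    field_simp
  rw [b, Real.mul_rpow (by positivity) (by positivity), ← Real.rpow_mul hx.le, ← Real.rpow_natCast,
    ← Real.rpow_mul hr.le, mul_one_div_cancel hk'.ne', Real.rpow_one]
  congr 2; ring

lemma fin_ii (H : ∀ᶠ ε in 𝓝[>] (0 : ℝ), Sol k ε (W ε) (W1 ε) (S ε) (R ε)) (hk : 1 ≤ k) (j : ℕ) :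
    Tendsto (fun ε => |W1 ε (R ε (j + 1))| * (kap k * ε) ^ ((1 - ((j : ℝ) + 1) * ((k : ℝ) + 2)) / k)) (𝓝[>] 0)
      (𝓝 (((k : ℝ) / (k + 2)) ^ ((1 : ℝ) / 2) * ((j : ℝ) + 1) ^ (((k : ℝ) + 1) / k) *
        Real.Gamma (j + 1) ^ (((k : ℝ) + 2) / k))) := by
  have hκ := kap_pos hk
  have hk' : (0 : ℝ) < k := by exact_mod_cast hk
  have hG : 0 < Real.Gamma ((j : ℝ) + 1) := Real.Gamma_pos_of_pos (by positivity)
  have h1 := (induct H hk j).1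
  have h2 := (fin_pre H hk j).2
  have l := (h2.mul h1).div (fin_i H hk j) (by positivity)
  have e : k * ((j : ℝ) + 1) * Real.Gamma (j + 1) / ((((k : ℝ) + 2) * k) ^ ((1 : ℝ) / 2) * ((j : ℝ) + 1) ^ (-(1 / (k : ℝ))) *
        Real.Gamma (j + 1) ^ (-(2 : ℝ) / k)) = ((k : ℝ) / (k + 2)) ^ ((1 : ℝ) / 2) * ((j : ℝ) + 1) ^ (((k : ℝ) + 1) / k) *
        Real.Gamma (j + 1) ^ (((k : ℝ) + 2) / k) := by
    have a1 : ((j : ℝ) + 1) ^ (((k : ℝ) + 1) / k) * ((j : ℝ) + 1) ^ (-(1 / (k : ℝ))) = (j : ℝ) + 1 := by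
      rw [← Real.rpow_add (by positivity)]
      nth_rewrite 2 [← Real.rpow_one ((j : ℝ) + 1)]
      congr 1; field_simp; ring
    have a2 : Real.Gamma (j + 1) ^ (((k : ℝ) + 2) / k) * Real.Gamma (j + 1) ^ (-(2 : ℝ) / k) = Real.Gamma (j + 1) := by
      rw [← Real.rpow_add hG]
      nth_rewrite 2 [← Real.rpow_one (Real.Gamma ((j : ℝ) + 1))]
      congr 1; field_simp; ring
    have a3 : ((k : ℝ) / (k + 2)) ^ ((1 : ℝ) / 2) * (((k : ℝ) + 2) * k) ^ ((1 : ℝ) / 2) = k := by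
      rw [← Real.mul_rpow (by positivity) (by positivity)]
      have : (k : ℝ) / (k + 2) * (((k : ℝ) + 2) * k) = k ^ 2 := by field_simp
      rw [this, ← Real.sqrt_eq_rpow, Real.sqrt_sq hk'.le]
    rw [div_eq_iff (by positivity)]
    calc k * ((j : ℝ) + 1) * Real.Gamma (j + 1)
        = (((k : ℝ) / (k + 2)) ^ ((1 : ℝ) / 2) * (((k : ℝ) + 2) * k) ^ ((1 : ℝ) / 2)) *
          (((j : ℝ) + 1) ^ (((k : ℝ) + 1) / k) * ((j : ℝ) + 1) ^ (-(1 / (k : ℝ)))) *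
          (Real.Gamma (j + 1) ^ (((k : ℝ) + 2) / k) * Real.Gamma (j + 1) ^ (-(2 : ℝ) / k)) := by
            rw [a1, a2, a3]
      _ = _ := by ring
  rw [e] at l
  refine l.congr' ?_
  filter_upwards [H, fam_pos] with ε h he
  have hx : 0 < kap k * ε := by positivity
  have hμ := h.mu_pos (show 1 ≤ j + 1 by omega)
  have hr := h.r_pos (show 1 ≤ j + 1 by omega)
  simp only [Pi.div_apply]
  have b : (kap k * ε) ^ ((1 - ((j : ℝ) + 1) * ((k : ℝ) + 2)) / k) * (kap k * ε) ^ ((2 * ((j : ℝ) + 1) - 1) / k)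
     * (kap k * ε) ^ (j + 1) = 1 := by
    rw [← Real.rpow_natCast, ← Real.rpow_add hx, ← Real.rpow_add hx]
    refine Eq.trans (congrArg (fun y : ℝ => (kap k * ε) ^ y) ?_) (Real.rpow_zero (kap k * ε))
    push_cast; field_simp; ring
  rw [div_eq_iff (by positivity)]
  calc _ = R ε (j + 1) * |W1 ε (R ε (j + 1))| / (kap k * ε) ^ (j + 1) * 1 := by
        rw [pow_succ]; field_simp
    _ = _ := by
        rw [mul_one, div_eq_iff (by positivity)]
        linear_combination -(R ε (j + 1) * |W1 ε (R ε (j + 1))|) * b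

lemma fin_iii (H : ∀ᶠ ε in 𝓝[>] (0 : ℝ), Sol k ε (W ε) (W1 ε) (S ε) (R ε)) (hk : 1 ≤ k) (j : ℕ) :
    Tendsto (fun ε => S ε (j + 1) *
        (kap k * ε) ^ ((2 * ((j : ℝ) + 1) * ((k : ℝ) + 2) - 3 * ((k : ℝ) + 2) + 2) / (((k : ℝ) + 2) * k))) (𝓝[>] 0)
      (𝓝 ((((k : ℝ) + 2) * k) ^ ((1 : ℝ) / 2) * (j : ℝ) ^ (1 / ((k : ℝ) + 2)) *
        Real.Gamma (j + 1) ^ (-(2 : ℝ) / k))) := by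
  have hκ := kap_pos hk
  have hC := CC_pos hk
  have hk' : (0 : ℝ) < k := by exact_mod_cast hk
  have hG : 0 < Real.Gamma ((j : ℝ) + 1) := Real.Gamma_pos_of_pos (by positivity)
  obtain ⟨h1, h2⟩ := induct H hk j
  have hε := mu_eps hk hG 1 (H.mono (fun ε h => h.mu_pos (show 1 ≤ j + 1 by omega))) h1
  have l := ((h2.mul hε).mul (h1.rpow_const (p := -(2 * ((k : ℝ) + 2) / k)) (Or.inl hG.ne'))).rpow_const
    (p := 1 / ((k : ℝ) + 2)) (Or.inr (by positivity))
  have e : (j * CC k * 1 * Real.Gamma (j + 1) ^ (-(2 * ((k : ℝ) + 2) / k))) ^ (1 / ((k : ℝ) + 2)) =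
    ((((k : ℝ) + 2) * k) ^ ((1 : ℝ) / 2) * (j : ℝ) ^ (1 / ((k : ℝ) + 2)) *
        Real.Gamma (j + 1) ^ (-(2 : ℝ) / k)) := by
    rw [mul_one, Real.mul_rpow (by positivity) (by positivity), Real.mul_rpow (by positivity) (by positivity),
      ← Real.rpow_mul hG.le]
    unfold CC
    rw [← Real.rpow_mul (by positivity), mul_comm ((j : ℝ) ^ _)]
    congr 2
    · congr 1; field_simp
    · field_simp
  rw [e] at l
  refine l.congr' ?_
  filter_upwards [H, fam_pos] with ε h he
  have hx : 0 < kap k * ε := by positivity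
  have hμ := h.mu_pos (show 1 ≤ j + 1 by omega)
  have hs := h.s_nonneg (show 1 ≤ j + 1 by omega)
  set μ := |W ε (S ε (j + 1))|
  have b1 : (μ / (kap k * ε) ^ j) ^ (-(2 * ((k : ℝ) + 2) / k)) =
     μ ^ (-(2 * ((k : ℝ) + 2) / k)) * (kap k * ε) ^ ((j : ℝ) * (2 * ((k : ℝ) + 2) / k)) := by
    rw [Real.div_rpow hμ.le (by positivity), ← Real.rpow_natCast _ j, ← Real.rpow_mul hx.le, div_eq_mul_inv,
      ← Real.rpow_neg hx.le]
    congr 2; ring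
  have b2 : μ ^ (pp k ε + 1) * μ ^ (1 * ε) * μ ^ (-(2 * ((k : ℝ) + 2) / k)) = 1 := by
    rw [← Real.rpow_add hμ, ← Real.rpow_add hμ]
    refine Eq.trans (congrArg (fun y : ℝ => μ ^ y) ?_) (Real.rpow_zero μ)
    unfold pp; field_simp; ring
  have b3 : (kap k * ε) ^ ((2 * ((j : ℝ) + 1) * ((k : ℝ) + 2) - 3 * ((k : ℝ) + 2) + 2) / k) =
    (kap k * ε) ^ ((j : ℝ) * (2 * ((k : ℝ) + 2) / k)) / (kap k * ε) := by
    rw [← Real.rpow_sub_one hx.ne']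
    congr 1; field_simp; ring
  have b4 : S ε (j + 1) ^ (k + 2) * μ ^ (pp k ε + 1) / (kap k * ε) * μ ^ (1 * ε) *
      (μ / (kap k * ε) ^ j) ^ (-(2 * ((k : ℝ) + 2) / k)) =
      S ε (j + 1) ^ (k + 2) * (kap k * ε) ^ ((2 * ((j : ℝ) + 1) * ((k : ℝ) + 2) - 3 * ((k : ℝ) + 2) + 2) / k) := by
    rw [b1, b3]
    linear_combination S ε (j + 1) ^ (k + 2) * (kap k * ε) ^ ((j : ℝ) * (2 * ((k : ℝ) + 2) / k)) / (kap k * ε) * b2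
  rw [b4, Real.mul_rpow (by positivity) (by positivity), ← Real.rpow_mul hx.le, ← Real.rpow_natCast,
    ← Real.rpow_mul hs]
  push_cast
  rw [mul_one_div_cancel (by positivity), Real.rpow_one]
  congr 2; field_simp

end fin

/-- **Corollary 1.6.** Asymptotic behavior of the zeros `r_{m,ε}`, the critical points
`s_{m,ε}`, and the values of the solution/derivative there, for the radial solution of
`-Δw = |w|^{4/(n-2)-ε} w` on `ℝⁿ` with `w(0) = 1`, `w'(0) = 0`. -/
theorem whole_space_asymptotics (n : ℕ) (hn : 3 ≤ n)
    (w : ℝ → ℝ → ℝ) (s r : ℝ → ℕ → ℝ)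
    (hw : ∀ ε ∈ Set.Ioo (0 : ℝ) (4 / ((n : ℝ) - 2)),
      ContDiffOn ℝ 2 (w ε) (Set.Ici 0) ∧ w ε 0 = 1 ∧ deriv (w ε) 0 = 0 ∧
      (∀ x ∈ Set.Ioi (0 : ℝ),
        deriv (fun t => t ^ (n - 1) * deriv (w ε) t) x
          = -(|w ε x| ^ (pEps n ε - 1) * w ε x * x ^ (n - 1))) ∧
      s ε 1 = 0 ∧
      (∀ i : ℕ, 1 ≤ i → s ε i < r ε i ∧ r ε i < s ε (i + 1)) ∧
      {x : ℝ | x ∈ Set.Ioi (0 : ℝ) ∧ w ε x = 0} = r ε '' {i : ℕ | 1 ≤ i} ∧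
      {x : ℝ | x ∈ Set.Ici (0 : ℝ) ∧ deriv (w ε) x = 0} = s ε '' {i : ℕ | 1 ≤ i}) :
    (∀ m : ℕ, 1 ≤ m →
      Tendsto (fun ε : ℝ => r ε m * (kappa n * ε) ^ ((2 * (m : ℝ) - 1) / ((n : ℝ) - 2)))
        (𝓝[>] (0 : ℝ))
        (𝓝 (((n : ℝ) * ((n : ℝ) - 2)) ^ ((1 : ℝ) / 2) * (m : ℝ) ^ ((1 : ℝ) / (2 - (n : ℝ))) *
          Real.Gamma (m : ℝ) ^ (-(2 : ℝ) / ((n : ℝ) - 2))))) ∧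
    (∀ m : ℕ, 1 ≤ m →
      Tendsto (fun ε : ℝ => |deriv (w ε) (r ε m)| *
          (kappa n * ε) ^ ((1 - (m : ℝ) * (n : ℝ)) / ((n : ℝ) - 2)))
        (𝓝[>] (0 : ℝ))
        (𝓝 ((((n : ℝ) - 2) / (n : ℝ)) ^ ((1 : ℝ) / 2) *
          (m : ℝ) ^ (((n : ℝ) - 1) / ((n : ℝ) - 2)) *
          Real.Gamma (m : ℝ) ^ ((n : ℝ) / ((n : ℝ) - 2))))) ∧
    (∀ m : ℕ, 2 ≤ m →
      Tendsto (fun ε : ℝ => s ε m *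
          (kappa n * ε) ^ ((2 * (m : ℝ) * (n : ℝ) - 3 * (n : ℝ) + 2) / ((n : ℝ) * ((n : ℝ) - 2))))
        (𝓝[>] (0 : ℝ))
        (𝓝 (((n : ℝ) * ((n : ℝ) - 2)) ^ ((1 : ℝ) / 2) * ((m : ℝ) - 1) ^ ((1 : ℝ) / (n : ℝ)) *
          Real.Gamma (m : ℝ) ^ (-(2 : ℝ) / ((n : ℝ) - 2))))) ∧
    (∀ m : ℕ, 2 ≤ m →
      Tendsto (fun ε : ℝ => |w ε (s ε m)| * (kappa n * ε) ^ (1 - (m : ℝ)))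
        (𝓝[>] (0 : ℝ)) (𝓝 (Real.Gamma (m : ℝ)))) := by
  obtain ⟨k, rfl⟩ : ∃ k, n = k + 2 := ⟨n - 2, by omega⟩
  have hk : 1 ≤ k := by omega
  have hk' : (0 : ℝ) < k := by exact_mod_cast hk
  have ec : (((k + 2 : ℕ) : ℝ)) = (k : ℝ) + 2 := by push_cast; ring
  have ec2 : (k : ℝ) + 2 - 2 = k := by ring
  have eκ : kappa (k + 2) = kap k := by
    unfold kappa kap
    rw [ec, ec2]
  have ep : ∀ ε, pEps (k + 2) ε = pp k ε := by
    intro ε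
    unfold pEps pp
    rw [ec, ec2]
    congr 2; ring
  have H : ∀ᶠ ε in 𝓝[>] (0 : ℝ),
      Sol k ε (w ε) (derivWithin (w ε) (Ici 0)) (s ε) (r ε) := by
    have hpos : (0 : ℝ) < 1 / k := by positivity
    filter_upwards [Ioo_mem_nhdsGT hpos] with ε he
    have hek : ε * k ≤ 1 := by
      have := he.2.le
      rwa [le_div_iff₀ hk'] at this
    have hlt : (1 : ℝ) / k ≤ 4 / k := by gcongr; norm_num
    obtain ⟨h1, h2, h3, h4, h5, h6, h7, h8⟩ := hw ε ⟨he.1, by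
      rw [ec, ec2]
      exact he.2.trans_le hlt⟩
    rw [ep] at h4
    exact Sol.of rfl hk he.1 hek h1 h2 h3 h4 h5 h6 h7 h8
  rw [eκ, ec, ec2]
  refine ⟨?_, ?_, ?_, ?_⟩
  · intro m hm
    obtain ⟨j, rfl⟩ : ∃ j, m = j + 1 := ⟨m - 1, by omega⟩
    have e1 : (1 : ℝ) / (2 - ((k : ℝ) + 2)) = -(1 / (k : ℝ)) := by
      rw [show (2 : ℝ) - ((k : ℝ) + 2) = -k by ring, div_neg]
    rw [e1]
    push_cast
    exact fin_i H hk j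
  · intro m hm
    obtain ⟨j, rfl⟩ : ∃ j, m = j + 1 := ⟨m - 1, by omega⟩
    have e1 : (k : ℝ) + 2 - 1 = k + 1 := by ring
    rw [e1]
    push_cast
    refine (fin_ii H hk j).congr' ?_
    filter_upwards [H] with ε h
    have hr := h.r_pos (show 1 ≤ j + 1 by omega)
    rw [derivWithin_of_mem_nhds (Ici_mem_nhds hr)]
  · intro m hm
    obtain ⟨j, rfl⟩ : ∃ j, m = j + 1 := ⟨m - 1, by omega⟩
    have e1 : ((j + 1 : ℕ) : ℝ) - 1 = j := by push_cast; ring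
    rw [e1]
    push_cast
    exact fin_iii H hk j
  · intro m hm
    obtain ⟨j, rfl⟩ : ∃ j, m = j + 1 := ⟨m - 1, by omega⟩
    have e1 : 1 - ((j + 1 : ℕ) : ℝ) = -j := by push_cast; ring
    rw [e1]
    push_cast
    exact fin_iv H hk j
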